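/- arXiv:1402.4153 — 5 statements merged into one kernel-verified Lean document; each statement's English description precedes it below -/
import Mathlib

section
/- Let k be a field with algebraic closure k̄, and let X, Y be geometrically integral k-varieties. If there exists a field extension L of k such that X_L is L-birational to Y_L, then there exists a finite field extension L' of k such that X_{L'} is L'-birational to Y_{L'}. -/
open AlgebraicGeometry CategoryTheory CategoryTheory.Limits

/-- A field extension of `k`, bundled. -/
structure FieldExtension (k : Type) [Field k] : Type 1 where
  /-- the underlying field -/
  carrier : Type
  [field : Field carrier]
  [alg : Algebra k carrier]

attribute [instance] FieldExtension.field FieldExtension.alg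

/-- The morphism `Spec F ⟶ Spec k` induced by a field extension `F/k`. -/
noncomputable def specMap (k F : Type) [Field k] [Field F] [Algebra k F] :
    Spec (CommRingCat.of F) ⟶ Spec (CommRingCat.of k) :=
  Spec.map (CommRingCat.ofHom (algebraMap k F))

section
variable {k : Type} [Field k] {X : Scheme.{0}} (p : X ⟶ Spec (CommRingCat.of k))

/-- The base change `X_F` of a `k`-scheme `X` along a field extension `F/k`. -/
noncomputable def bc (F : Type) [Field F] [Algebra k F] : Scheme.{0} :=
  pullback p (specMap k F)

/-- The structure morphism of the base change `X_F ⟶ Spec F`. -/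
noncomputable def bcStruct (F : Type) [Field F] [Algebra k F] :
    bc p F ⟶ Spec (CommRingCat.of F) :=
  pullback.snd p (specMap k F)

end

section
variable {k : Type} [Field k]

/-- Two `k`-varieties `X`, `Y` become birational over a field extension `L/k`:
the base changes `X_L` and `Y_L` contain isomorphic nonempty open subschemes,
the isomorphism being a morphism over `L`. -/
def BirationalOver {X Y : Scheme.{0}}
    (pX : X ⟶ Spec (CommRingCat.of k)) (pY : Y ⟶ Spec (CommRingCat.of k))
    (L : Type) [Field L] [Algebra k L] : Prop :=
  ∃ (U : (bc pX L).Opens) (V : (bc pY L).Opens), U ≠ ⊥ ∧ V ≠ ⊥ ∧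
    ∃ e : U.toScheme ≅ V.toScheme,
      e.hom ≫ V.ι ≫ bcStruct pY L = U.ι ≫ bcStruct pX L

end

open scoped TensorProduct

section algebraPart

/-- The localization `P[1/f]` inside a field `K`. -/
def locSub {k K : Type} [Field k] [Field K] [Algebra k K] (P : Subalgebra k K) (f : K)
    (hf : f ∈ P) : Subalgebra k K where
  carrier := {x | ∃ n : ℕ, f ^ n * x ∈ P}
  mul_mem' := by
    rintro x y ⟨n, hn⟩ ⟨m, hm⟩
    refine ⟨n + m, ?_⟩
    have := P.mul_mem hn hm
    rwa [show f ^ (n + m) * (x * y) = f ^ n * x * (f ^ m * y) by ring]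
  add_mem' := by
    rintro x y ⟨n, hn⟩ ⟨m, hm⟩
    refine ⟨n + m, ?_⟩
    have := P.add_mem (P.mul_mem (P.pow_mem hf m) hn) (P.mul_mem (P.pow_mem hf n) hm)
    rwa [show f ^ (n + m) * (x + y) = f ^ m * (f ^ n * x) + f ^ n * (f ^ m * y) by ring]
  algebraMap_mem' := fun r => ⟨0, by simp⟩

variable {k K : Type} [Field k] [Field K] [Algebra k K]

theorem le_locSub (P : Subalgebra k K) (f : K) (hf : f ∈ P) : P ≤ locSub P f hf :=
  fun x hx => ⟨0, by simpa using hx⟩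

theorem inv_mem_locSub (P : Subalgebra k K) (f : K) (hf : f ∈ P) (h0 : f ≠ 0) :
    f⁻¹ ∈ locSub P f hf :=
  ⟨1, by simp [h0]⟩

theorem locSub_le (P D : Subalgebra k K) (f : K) (hf : f ∈ P) (h0 : f ≠ 0) (h : P ≤ D)
    (hi : f⁻¹ ∈ D) : locSub P f hf ≤ D := by
  rintro x ⟨n, hn⟩
  have := D.mul_mem (D.pow_mem hi n) (h hn)
  rwa [← mul_assoc, ← mul_pow, inv_mul_cancel₀ h0, one_pow, one_mul] at this

theorem locSub_le_aux (P Q : Subalgebra k K) (f g h h' : K) (hf : f ∈ P) (hg : g ∈ Q)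
    (hh : h ∈ P) (hh' : h' ∈ Q) (f0 : f ≠ 0) (g0 : g ≠ 0) (hh0 : h ≠ 0) (hh0' : h' ≠ 0)
    (hQ : Q ≤ locSub P f hf) (n m : ℕ) (e : f ^ n * g = h) (e' : g ^ m * f = h') :
    locSub Q (g * h') (Q.mul_mem hg hh') ≤ locSub P (f * h) (P.mul_mem hf hh) := by
  have hP := le_locSub P (f * h) (P.mul_mem hf hh)
  have hI := inv_mem_locSub P (f * h) (P.mul_mem hf hh) (mul_ne_zero f0 hh0)
  set D := locSub P (f * h) (P.mul_mem hf hh)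
  have hfi : f⁻¹ ∈ D := by
    have := D.mul_mem (hP hh) hI
    rwa [show h * (f * h)⁻¹ = f⁻¹ by field_simp] at this
  have hhi : h⁻¹ ∈ D := by
    have := D.mul_mem (hP hf) hI
    rwa [show f * (f * h)⁻¹ = h⁻¹ by field_simp] at this
  have hgi : g⁻¹ ∈ D := by
    have := D.mul_mem (D.pow_mem (hP hf) n) hhi
    rwa [show f ^ n * h⁻¹ = g⁻¹ by rw [← e]; field_simp] at this
  have hhi' : h'⁻¹ ∈ D := by
    have := D.mul_mem (D.pow_mem hgi m) hfi
    rwa [show g⁻¹ ^ m * f⁻¹ = h'⁻¹ by rw [← e', mul_inv, inv_pow]] at this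
  refine locSub_le _ _ _ _ (mul_ne_zero g0 hh0') (hQ.trans (locSub_le _ _ _ _ f0 hP hfi)) ?_
  rw [mul_inv]
  exact D.mul_mem hgi hhi'

theorem exists_locSub_eq (P Q : Subalgebra k K) (f g : K) (hf : f ∈ P) (hg : g ∈ Q)
    (f0 : f ≠ 0) (g0 : g ≠ 0) (hQ : Q ≤ locSub P f hf) (hP : P ≤ locSub Q g hg) :
    ∃ (f1 : K) (h1 : f1 ∈ P) (g1 : K) (h2 : g1 ∈ Q), f1 ≠ 0 ∧ g1 ≠ 0 ∧
      locSub P f1 h1 = locSub Q g1 h2 := by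
  obtain ⟨n, hn⟩ := hQ hg
  obtain ⟨m, hm⟩ := hP hf
  have h1 : f ^ n * g ≠ 0 := by positivity
  have h2 : g ^ m * f ≠ 0 := by positivity
  refine ⟨_, P.mul_mem hf hn, _, Q.mul_mem hg hm, by positivity, by positivity, ?_⟩
  apply le_antisymm
  · exact locSub_le_aux Q P g f _ _ hg hf hm hn g0 f0 h2 h1 hP m n rfl rfl
  · exact locSub_le_aux P Q f g _ _ hf hg hn hm f0 g0 h1 h2 hQ n m rfl rfl

theorem isLocalization_locSub (P : Subalgebra k K) (f : K) (hf : f ∈ P) (h0 : f ≠ 0)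
    {T : Type} [CommRing T] (φ : T →+* locSub P f hf)
    (hinj : Function.Injective φ) (hr : ∀ x : locSub P f hf, (x : K) ∈ P → x ∈ φ.range) :
    ∃ t : T, @IsLocalization.Away _ _ t (locSub P f hf) _ φ.toAlgebra := by
  obtain ⟨t, ht⟩ := hr ⟨f, le_locSub P f hf hf⟩ hf
  refine ⟨t, ?_⟩
  let _ := φ.toAlgebra
  have hu : IsUnit (φ t) := by
    rw [ht]
    refine IsUnit.of_mul_eq_one ⟨f⁻¹, inv_mem_locSub P f hf h0⟩ ?_
    ext
    simp [h0]
  refine (isLocalization_iff ..).2 ⟨?_, ?_, ?_⟩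
  · rintro ⟨_, n, rfl⟩
    simpa [RingHom.algebraMap_toAlgebra] using hu.pow n
  · rintro ⟨x, n, hn⟩
    obtain ⟨s, hs⟩ := hr ⟨f ^ n * x, le_locSub P f hf hn⟩ hn
    refine ⟨(s, ⟨t ^ n, n, rfl⟩), ?_⟩
    simp only [RingHom.algebraMap_toAlgebra, hs, map_pow, ht]
    ext
    simp [mul_comm]
  · intro x y hxy
    exact ⟨1, by rw [hinj hxy]⟩

variable {L : Type} [Field L] [Algebra k L]

theorem exists_finset_mem {A : Type} [CommRing A] [Algebra k A] (a : A →ₐ[k] K) (l : L →ₐ[k] K)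
    (x : K) (hx : x ∈ a.range ⊔ l.range) :
    ∃ s : Finset L, x ∈ a.range ⊔ (Algebra.adjoin k (s : Set L)).map l := by
  classical
  have mono : ∀ s t : Finset L, s ⊆ t → a.range ⊔ (Algebra.adjoin k (s : Set L)).map l ≤
      a.range ⊔ (Algebra.adjoin k (t : Set L)).map l := fun s t h =>
    sup_le_sup_left (Subalgebra.map_mono (Algebra.adjoin_mono (by exact_mod_cast h))) _
  rw [← Algebra.adjoin_eq a.range, ← Algebra.adjoin_eq l.range, ← Algebra.adjoin_union] at hx
  induction hx using Algebra.adjoin_induction with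
  | mem x hx =>
    rcases hx with hx | ⟨y, rfl⟩
    · exact ⟨∅, (le_sup_left : a.range ≤ _) hx⟩
    · refine ⟨{y}, (le_sup_right : (Algebra.adjoin k (({y} : Finset L) : Set L)).map l ≤ _) ?_⟩
      exact ⟨y, Algebra.subset_adjoin (by simp), rfl⟩
  | algebraMap r => exact ⟨∅, Subalgebra.algebraMap_mem _ _⟩
  | add x y _ _ hx hy =>
    obtain ⟨s, hs⟩ := hx
    obtain ⟨t, ht⟩ := hy
    exact ⟨s ∪ t, Subalgebra.add_mem _ (mono _ _ Finset.subset_union_left hs)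
      (mono _ _ Finset.subset_union_right ht)⟩
  | mul x y _ _ hx hy =>
    obtain ⟨s, hs⟩ := hx
    obtain ⟨t, ht⟩ := hy
    exact ⟨s ∪ t, Subalgebra.mul_mem _ (mono _ _ Finset.subset_union_left hs)
      (mono _ _ Finset.subset_union_right ht)⟩

theorem exists_finset_den {A : Type} [CommRing A] [Algebra k A] (a : A →ₐ[k] K) (l : L →ₐ[k] K)
    (hfrac : ∀ x : K, ∃ u ∈ a.range ⊔ l.range, ∃ v ∈ a.range ⊔ l.range, v ≠ 0 ∧ v * x = u)
    (S : Finset K) :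
    ∃ s : Finset L, ∀ t : Finset L, s ⊆ t → ∃ f ∈ a.range ⊔ (Algebra.adjoin k (t : Set L)).map l,
      f ≠ 0 ∧ ∀ x ∈ S, f * x ∈ a.range ⊔ (Algebra.adjoin k (t : Set L)).map l := by
  classical
  have mono : ∀ s t : Finset L, s ⊆ t → a.range ⊔ (Algebra.adjoin k (s : Set L)).map l ≤
      a.range ⊔ (Algebra.adjoin k (t : Set L)).map l := fun s t h =>
    sup_le_sup_left (Subalgebra.map_mono (Algebra.adjoin_mono (by exact_mod_cast h))) _
  induction S using Finset.induction_on with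
  | empty => exact ⟨∅, fun t _ => ⟨1, Subalgebra.one_mem _, one_ne_zero, by simp⟩⟩
  | insert x S _ ih =>
    obtain ⟨s, hs⟩ := ih
    obtain ⟨u, hu, v, hv, v0, e⟩ := hfrac x
    obtain ⟨s1, h1⟩ := exists_finset_mem a l u hu
    obtain ⟨s2, h2⟩ := exists_finset_mem a l v hv
    refine ⟨s ∪ (s1 ∪ s2), fun t ht => ?_⟩
    have ht1 := Finset.union_subset_iff.1 ht
    have ht2 := Finset.union_subset_iff.1 ht1.2
    obtain ⟨f, hf, f0, hfS⟩ := hs t ht1.1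
    have h1 := mono _ _ ht2.1 h1
    have h2 := mono _ _ ht2.2 h2
    refine ⟨v * f, Subalgebra.mul_mem _ h2 hf, mul_ne_zero v0 f0, fun y hy => ?_⟩
    rcases Finset.mem_insert.1 hy with rfl | hy
    · rw [show v * f * y = f * (v * y) by ring, e]
      exact Subalgebra.mul_mem _ hf h1
    · rw [mul_assoc]
      exact Subalgebra.mul_mem _ h2 (hfS y hy)

theorem sup_le_locSub {B R : Type} [CommRing B] [Algebra k B] [CommRing R] [Algebra k R]
    (P : Subalgebra k K) (f : K) (hf : f ∈ P) (S : Finset B)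
    (hS : Algebra.adjoin k (S : Set B) = ⊤) (b : B →ₐ[k] K) (Q : Subalgebra k K) (hQ : Q ≤ P)
    (h : ∀ x ∈ S, f * b x ∈ P) : b.range ⊔ Q ≤ locSub P f hf := by
  refine sup_le ?_ (hQ.trans (le_locSub _ _ _))
  rw [← Algebra.map_top, ← hS, AlgHom.map_adjoin, Algebra.adjoin_le_iff]
  rintro _ ⟨x, hx, rfl⟩
  exact ⟨1, by simpa using h x hx⟩

/-- The algebraic core. -/
theorem algebra_core {A B : Type} [CommRing A] [Algebra k A] [CommRing B] [Algebra k B]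
    [Algebra.FiniteType k A] [Algebra.FiniteType k B]
    (a : A →ₐ[k] K) (b : B →ₐ[k] K) (l : L →ₐ[k] K)
    (hA : Function.Injective (Algebra.TensorProduct.productMap a l))
    (hB : Function.Injective (Algebra.TensorProduct.productMap b l))
    (hfA : ∀ x : K, ∃ u v, Algebra.TensorProduct.productMap a l v ≠ 0 ∧
      Algebra.TensorProduct.productMap a l v * x = Algebra.TensorProduct.productMap a l u)
    (hfB : ∀ x : K, ∃ u v, Algebra.TensorProduct.productMap b l v ≠ 0 ∧
      Algebra.TensorProduct.productMap b l v * x = Algebra.TensorProduct.productMap b l u) :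
    ∃ (R C : Type) (_ : CommRing R) (_ : CommRing C) (_ : Algebra k R) (_ : Algebra k C)
      (_ : Algebra.FiniteType k R) (_ : Nontrivial C)
      (a' : A →ₐ[k] C) (b' : B →ₐ[k] C) (r : R →ₐ[k] C)
      (f : A ⊗[k] R) (g : B ⊗[k] R),
      (@IsLocalization.Away _ _ f C _ (Algebra.TensorProduct.productMap a' r).toRingHom.toAlgebra) ∧
      (@IsLocalization.Away _ _ g C _ (Algebra.TensorProduct.productMap b' r).toRingHom.toAlgebra)
       := by
  classical
  obtain ⟨SA, hSA⟩ := Algebra.FiniteType.out (R := k) (A := A)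
  obtain ⟨SB, hSB⟩ := Algebra.FiniteType.out (R := k) (A := B)
  obtain ⟨s1, h1⟩ := exists_finset_den a l (fun x => by
    obtain ⟨u, v, hv, e⟩ := hfA x
    rw [← Algebra.TensorProduct.productMap_range]
    exact ⟨_, ⟨u, rfl⟩, _, ⟨v, rfl⟩, hv, e⟩) (SB.image b)
  obtain ⟨s2, h2⟩ := exists_finset_den b l (fun x => by
    obtain ⟨u, v, hv, e⟩ := hfB x
    rw [← Algebra.TensorProduct.productMap_range]
    exact ⟨_, ⟨u, rfl⟩, _, ⟨v, rfl⟩, hv, e⟩) (SA.image a)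
  obtain ⟨f, hf, f0, hfS⟩ := h1 (s1 ∪ s2) Finset.subset_union_left
  obtain ⟨g, hg, g0, hgS⟩ := h2 (s1 ∪ s2) Finset.subset_union_right
  set R := Algebra.adjoin k ((s1 ∪ s2 : Finset L) : Set L) with hR
  obtain ⟨f1, hf1, g1, hg1, f10, g10, e⟩ := exists_locSub_eq _ _ f g hf hg f0 g0
    (sup_le_locSub (R := R) _ f hf SB hSB b _ le_sup_right (fun x hx => hfS _ (Finset.mem_image_of_mem _ hx)))
    (sup_le_locSub (R := R) _ g hg SA hSA a _ le_sup_right (fun x hx => hgS _ (Finset.mem_image_of_mem _ hx)))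
  have key : ∀ {D : Type} [CommRing D] [Algebra k D] (d : D →ₐ[k] K)
      (hd : Function.Injective (Algebra.TensorProduct.productMap d l))
      (f : K) (hf : f ∈ d.range ⊔ R.map l) (f0 : f ≠ 0) (C : Subalgebra k K)
      (hC : C = locSub _ f hf) (d' : D →ₐ[k] C) (r : R →ₐ[k] C) (hd' : C.val.comp d' = d)
      (hr : C.val.comp r = l.comp R.val),
      ∃ t : D ⊗[k] R, @IsLocalization.Away _ _ t C _
        (Algebra.TensorProduct.productMap d' r).toRingHom.toAlgebra := by
    intro D _ _ d hd f hf f0 C hC d' r hd' hr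
    subst hC
    have hcomp : ∀ x, ((Algebra.TensorProduct.productMap d' r x : locSub _ f hf) : K) =
        Algebra.TensorProduct.productMap d (l.comp R.val) x := by
      intro x
      have : (locSub _ f hf).val.comp (Algebra.TensorProduct.productMap d' r) =
          Algebra.TensorProduct.productMap d (l.comp R.val) := by
        ext x
        · simpa using DFunLike.congr_fun hd' x
        · simpa using DFunLike.congr_fun hr x
      exact DFunLike.congr_fun this x
    have hcomp2 : ∀ x, Algebra.TensorProduct.productMap d (l.comp R.val) x =
        Algebra.TensorProduct.productMap d l
          (Algebra.TensorProduct.map (AlgHom.id k D) R.val x) := by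
      intro x
      have : Algebra.TensorProduct.productMap d (l.comp R.val) =
        (Algebra.TensorProduct.productMap d l).comp
          (Algebra.TensorProduct.map (AlgHom.id k D) R.val) := by
        ext x <;> simp
      exact DFunLike.congr_fun this x
    apply isLocalization_locSub _ f hf f0
    · intro x y hxy
      have h3 := congrArg (Subtype.val) hxy
      have h4 : Algebra.TensorProduct.productMap d (l.comp R.val) x =
        Algebra.TensorProduct.productMap d (l.comp R.val) y :=
        (hcomp x).symm.trans (h3.trans (hcomp y))
      rw [hcomp2, hcomp2] at h4
      have h5 := hd h4
      exact Module.Flat.lTensor_preserves_injective_linearMap (M := D) R.val.toLinearMap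
        Subtype.val_injective h5
    · intro x hx
      have : d.range ⊔ R.map l = (Algebra.TensorProduct.productMap d (l.comp R.val)).range := by
        rw [Algebra.TensorProduct.productMap_range, AlgHom.range_comp, Subalgebra.range_val]
      have hx := this.le hx
      obtain ⟨y, hy⟩ := hx
      exact ⟨y, Subtype.ext ((hcomp y).trans hy)⟩
  have hC1 := le_locSub _ f1 hf1
  have hC2 : b.range ⊔ R.map l ≤ locSub _ f1 hf1 := e ▸ le_locSub _ g1 hg1
  set C := locSub _ f1 hf1 with hCdef
  let a' : A →ₐ[k] C := a.codRestrict C (fun x => hC1 ((le_sup_left : a.range ≤ _) ⟨x, rfl⟩))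
  let b' : B →ₐ[k] C := b.codRestrict C (fun x => hC2 ((le_sup_left : b.range ≤ _) ⟨x, rfl⟩))
  let r : R →ₐ[k] C := (l.comp R.val).codRestrict C
    (fun x => hC1 ((le_sup_right : R.map l ≤ _) ⟨x, x.2, rfl⟩))
  obtain ⟨t, ht⟩ := key a hA f1 hf1 f10 C rfl a' r (by ext; rfl) (by ext; rfl)
  obtain ⟨u, hu⟩ := key b hB g1 hg1 g10 C e b' r (by ext; rfl) (by ext; rfl)
  refine ⟨R, C, inferInstance, inferInstance, inferInstance, inferInstance, ?_, inferInstance,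
    a', b', r, t, u, ht, hu⟩
  exact R.fg_iff_finiteType.1 ⟨_, rfl⟩

end algebraPart

/-- Base change of an open immersion over `T` along `T' ⟶ T`. -/
theorem isOpenImmersion_baseChange {X S T T' W : Scheme.{0}} (p : X ⟶ S) (q : T ⟶ S)
    (s : T' ⟶ T) (q' : T' ⟶ S) (hq : s ≫ q = q') (w : W ⟶ T) (i : W ⟶ pullback p q) [IsOpenImmersion i]
    (hi : i ≫ pullback.snd p q = w) :
    ∃ j : pullback w s ⟶ pullback p q', IsOpenImmersion j ∧
      j ≫ pullback.snd p q' = pullback.snd w s := by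
  subst hq hi
  let m : pullback p (s ≫ q) ⟶ pullback p q :=
    pullback.lift (pullback.fst _ _) (pullback.snd _ _ ≫ s) (by simp [pullback.condition])
  have hm : IsPullback m (pullback.snd p (s ≫ q)) (pullback.snd p q) s := by
    have h1 : IsPullback (m ≫ pullback.fst p q) (pullback.snd p (s ≫ q)) p (s ≫ q) := by
      rw [pullback.lift_fst]; exact IsPullback.of_hasPullback p (s ≫ q)
    exact IsPullback.of_right h1 (pullback.lift_snd _ _ _) (IsPullback.of_hasPullback p q)
  let j : pullback (i ≫ pullback.snd p q) s ⟶ pullback p (s ≫ q) :=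
    hm.lift (pullback.fst _ _ ≫ i) (pullback.snd _ _) (by simp [pullback.condition])
  have hj : j ≫ pullback.snd p (s ≫ q) = pullback.snd _ _ := hm.lift_snd _ _ _
  have hj' : j ≫ m = pullback.fst _ _ ≫ i := hm.lift_fst _ _ _
  refine ⟨j, ?_, hj⟩
  have h2 : IsPullback (pullback.fst (i ≫ pullback.snd p q) s) j i m := by
    have h3 : IsPullback (pullback.fst (i ≫ pullback.snd p q) s) (j ≫ pullback.snd p (s ≫ q))
      (i ≫ pullback.snd p q) s := by
      rw [hj]; exact IsPullback.of_hasPullback _ _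
    exact IsPullback.of_bot h3 hj'.symm hm
  exact MorphismProperty.of_isPullback (P := @IsOpenImmersion) h2 inferInstance

theorem stalk_fraction' {T : CommRingCat.{0}} [IsDomain T] (y : PrimeSpectrum T) :
    Function.Injective (StructureSheaf.toStalk T y).hom ∧
    ∀ x, ∃ u v, v ≠ 0 ∧ (StructureSheaf.toStalk T y).hom v * x =
      (StructureSheaf.toStalk T y).hom u := by
  have hloc := StructureSheaf.IsLocalization.to_stalk T y
  have hle : y.asIdeal.primeCompl ≤ nonZeroDivisors T := by
    intro t ht
    rw [mem_nonZeroDivisors_iff_ne_zero]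
    rintro rfl
    exact ht (Ideal.zero_mem _)
  constructor
  · exact IsLocalization.injective ((Spec.structureSheaf T).presheaf.stalk y) hle
  · intro x
    obtain ⟨⟨u, v⟩, h⟩ := IsLocalization.surj (S := (Spec.structureSheaf T).presheaf.stalk y)
      y.asIdeal.primeCompl x
    refine ⟨u, v, nonZeroDivisors.ne_zero (hle v.2), ?_⟩
    rw [mul_comm]
    exact h

theorem stalk_fraction {T : CommRingCat.{0}} [IsDomain T] (y : Spec T) :
    Function.Injective ((Scheme.ΓSpecIso T).inv ≫ (Spec T).presheaf.germ ⊤ y trivial).hom ∧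
    ∀ x, ∃ u v, v ≠ 0 ∧ ((Scheme.ΓSpecIso T).inv ≫ (Spec T).presheaf.germ ⊤ y trivial).hom v * x =
      ((Scheme.ΓSpecIso T).inv ≫ (Spec T).presheaf.germ ⊤ y trivial).hom u :=
  stalk_fraction' y

theorem fraction_lemma {W : Scheme.{0}} [IsIntegral W] {T : CommRingCat.{0}} [IsDomain T]
    (h : W ⟶ Spec T) [IsOpenImmersion h] (φ : T ⟶ W.presheaf.stalk (genericPoint W))
    (hφ : W.fromSpecStalk (genericPoint W) ≫ h = Spec.map φ) :
    Function.Injective φ.hom ∧ ∀ x, ∃ u v, φ.hom v ≠ 0 ∧ φ.hom v * x = φ.hom u := by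
  have e1 : φ = ((Scheme.ΓSpecIso T).inv ≫ (Spec T).presheaf.germ ⊤ (h (genericPoint W)) trivial)
      ≫ h.stalkMap (genericPoint W) := by
    apply Spec.map_injective
    rw [Spec.map_comp, ← Spec.fromSpecStalk_eq, Scheme.SpecMap_stalkMap_fromSpecStalk, hφ]
  obtain ⟨hi, hs⟩ := stalk_fraction (h (genericPoint W))
  have hb : Function.Bijective (h.stalkMap (genericPoint W)).hom :=
    ConcreteCategory.bijective_of_isIso (h.stalkMap (genericPoint W))
  have hinj : Function.Injective φ.hom := by
    rw [e1, CommRingCat.hom_comp]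
    exact hb.1.comp hi
  refine ⟨hinj, fun x => ?_⟩
  obtain ⟨x, rfl⟩ := hb.2 x
  obtain ⟨u, v, hv, e⟩ := hs x
  refine ⟨u, v, (map_ne_zero_iff _ hinj).2 hv, ?_⟩
  rw [e1, CommRingCat.hom_comp, RingHom.comp_apply, RingHom.comp_apply, ← map_mul, e]

/-- affine chart around a point -/
theorem exists_chart {k : Type} [Field k] {X : Scheme.{0}} (p : X ⟶ Spec (CommRingCat.of k))
    [LocallyOfFiniteType p] (x : X) :
    ∃ (A : Type) (_ : CommRing A) (_ : Algebra k A) (φ : Spec (CommRingCat.of A) ⟶ X),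
      Algebra.FiniteType k A ∧ IsOpenImmersion φ ∧ x ∈ Set.range φ ∧
      φ ≫ p = Spec.map (CommRingCat.ofHom (algebraMap k A)) := by
  obtain ⟨R, f, hf, hx, -⟩ := Scheme.exists_affine_mem_range_and_range_subset (x := x) (U := ⊤) trivial
  obtain ⟨g, hg⟩ := Spec.map_surjective (f ≫ p)
  let _ : Algebra k R := g.hom.toAlgebra
  refine ⟨R, inferInstance, inferInstance, f, ?_, hf, hx, hg.symm⟩
  have : LocallyOfFiniteType (Spec.map g) := hg ▸ inferInstance
  exact (HasRingHomProperty.Spec_iff (P := @LocallyOfFiniteType)).1 this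

theorem isOpenImmersion_chart {X X' S T : Scheme.{0}} (p : X ⟶ S) (q : T ⟶ S)
    (φ : X' ⟶ X) [IsOpenImmersion φ] (p' : X' ⟶ S) (h : φ ≫ p = p') :
    ∃ j : pullback p' q ⟶ pullback p q, IsOpenImmersion j ∧ j ≫ pullback.fst p q = pullback.fst p' q ≫ φ
      ∧ j ≫ pullback.snd p q = pullback.snd p' q := by
  subst h
  let j : pullback (φ ≫ p) q ⟶ pullback p q := 
    pullback.lift (pullback.fst _ _ ≫ φ) (pullback.snd _ _) (by simp [pullback.condition])
  have hj : j ≫ pullback.fst p q = pullback.fst (φ ≫ p) q ≫ φ := pullback.lift_fst _ _ _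
  have hj' : j ≫ pullback.snd p q = pullback.snd (φ ≫ p) q := pullback.lift_snd _ _ _
  have h1 : IsPullback j (pullback.fst _ _) (pullback.fst p q) φ := by
    have h2 : IsPullback (j ≫ pullback.snd p q) (pullback.fst (φ ≫ p) q) q (φ ≫ p) := by
      rw [hj']; exact (IsPullback.of_hasPullback _ _).flip
    exact IsPullback.of_right h2 hj (IsPullback.of_hasPullback p q).flip
  refine ⟨j, ?_, hj, hj'⟩
  exact MorphismProperty.of_isPullback (P := @IsOpenImmersion) h1.flip inferInstance


theorem exists_generic (W : Scheme.{0}) [IsIntegral W] :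
    ∃ (K : Type) (_ : Field K) (s : Spec (CommRingCat.of K) ⟶ W),
      ∀ (T : CommRingCat.{0}) (_ : IsDomain T) (h : W ⟶ Spec T) (_ : IsOpenImmersion h)
        (φ : T ⟶ CommRingCat.of K), s ≫ h = Spec.map φ →
        Function.Injective φ.hom ∧ ∀ x, ∃ u v, φ.hom v ≠ 0 ∧ φ.hom v * x = φ.hom u :=
  ⟨W.functionField, inferInstance, W.fromSpecStalk (genericPoint W),
    fun T _ h _ φ hφ => fraction_lemma h φ hφ⟩

theorem isIntegral_of_mono_open {W Z : Scheme.{0}} (i : W ⟶ Z) (_ : IsOpenImmersion i)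
    (_ : IsIntegral Z) (_ : Nonempty W) : IsIntegral W :=
  isIntegral_of_isOpenImmersion i

theorem frac_data {k L K A : Type} [Field k] [Field L] [Field K] [Algebra k L] [Algebra k K]
    [CommRing A] [Algebra k A] {X W : Scheme.{0}} (p : X ⟶ Spec (CommRingCat.of k))
    (hX : IsIntegral (pullback p (Spec.map (CommRingCat.ofHom (algebraMap k L))))) [Nonempty W]
    (φ : Spec (CommRingCat.of A) ⟶ X) [IsOpenImmersion φ]
    (hφ : φ ≫ p = Spec.map (CommRingCat.ofHom (algebraMap k A)))
    (w : W ⟶ pullback p (Spec.map (CommRingCat.ofHom (algebraMap k L)))) (how : IsOpenImmersion w) (c : W ⟶ Spec (CommRingCat.of A))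
    (hc : c ≫ φ = w ≫ pullback.fst p (Spec.map (CommRingCat.ofHom (algebraMap k L))))
    (s : Spec (CommRingCat.of K) ⟶ W)
    (hs : ∀ (T : CommRingCat.{0}) (_ : IsDomain T) (h : W ⟶ Spec T) (_ : IsOpenImmersion h)
        (φ : T ⟶ CommRingCat.of K), s ≫ h = Spec.map φ →
        Function.Injective φ.hom ∧ ∀ x, ∃ u v, φ.hom v ≠ 0 ∧ φ.hom v * x = φ.hom u)
    (l : L →ₐ[k] K) (hl : s ≫ w ≫ pullback.snd p (Spec.map (CommRingCat.ofHom (algebraMap k L))) = Spec.map (CommRingCat.ofHom l.toRingHom)) :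
    ∃ a : A →ₐ[k] K, Function.Injective (Algebra.TensorProduct.productMap a l) ∧
      ∀ x : K, ∃ u v, Algebra.TensorProduct.productMap a l v ≠ 0 ∧
      Algebra.TensorProduct.productMap a l v * x = Algebra.TensorProduct.productMap a l u := by
  obtain ⟨j, hj, hj1, hj2⟩ := isOpenImmersion_chart p (Spec.map (CommRingCat.ofHom (algebraMap k L))) φ _ hφ
  let c' : W ⟶ pullback (Spec.map (CommRingCat.ofHom (algebraMap k A))) (Spec.map (CommRingCat.ofHom (algebraMap k L))) :=
    pullback.lift c (w ≫ pullback.snd p (Spec.map (CommRingCat.ofHom (algebraMap k L)))) (by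
      rw [← hφ, reassoc_of% hc, Category.assoc]
      rw [pullback.condition])
  have hc1 : c' ≫ pullback.fst _ _ = c := pullback.lift_fst _ _ _
  have hc2 : c' ≫ pullback.snd _ _ = w ≫ pullback.snd p (Spec.map (CommRingCat.ofHom (algebraMap k L))) := pullback.lift_snd _ _ _
  have hcj : c' ≫ j = w := by
    apply pullback.hom_ext
    · rw [Category.assoc, hj1, reassoc_of% hc1, hc]
    · rw [Category.assoc, hj2, hc2]
  have hoc : IsOpenImmersion c' := by
    have : IsOpenImmersion (c' ≫ j) := hcj ▸ how
    exact IsOpenImmersion.of_comp c' j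
  let e := pullbackSpecIso k A L
  let h : W ⟶ Spec (CommRingCat.of (A ⊗[k] L)) := c' ≫ e.hom
  have hoh : IsOpenImmersion h := by
    have : IsOpenImmersion e.hom := inferInstance
    exact MorphismProperty.comp_mem @IsOpenImmersion _ _ hoc this
  have hP := isIntegral_of_mono_open j hj hX (Nonempty.map c' inferInstance)
  have hT : IsIntegral (Spec (CommRingCat.of (A ⊗[k] L))) :=
    isIntegral_of_mono_open e.inv inferInstance hP (Nonempty.map h inferInstance)
  have hD : IsDomain (CommRingCat.of (A ⊗[k] L)) := (affine_isIntegral_iff _).1 hT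
  obtain ⟨θ, hθ⟩ := Spec.map_surjective (s ≫ h)
  obtain ⟨h1, h2⟩ := hs _ hD h hoh θ hθ.symm
  have hL : θ.hom.comp (Algebra.TensorProduct.includeRight : L →ₐ[k] A ⊗[k] L).toRingHom =
      l.toRingHom := by
    have : CommRingCat.ofHom (Algebra.TensorProduct.includeRight : L →ₐ[k] A ⊗[k] L).toRingHom ≫ θ
        = CommRingCat.ofHom l.toRingHom := by
      apply Spec.map_injective
      rw [Spec.map_comp, hθ, ← hl, ← hc2]
      rw [← pullbackSpecIso_hom_snd k A L, Category.assoc, Category.assoc]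
      rfl
    exact congrArg CommRingCat.Hom.hom this
  let θ' : A ⊗[k] L →ₐ[k] K := { θ.hom with
    commutes' := fun x => by
      have h3 : (algebraMap k (A ⊗[k] L)) x =
        (Algebra.TensorProduct.includeRight : L →ₐ[k] A ⊗[k] L) (algebraMap k L x) := by simp
      have h4 := RingHom.congr_fun hL (algebraMap k L x)
      change θ.hom (algebraMap k (A ⊗[k] L) x) = _
      rw [h3]
      refine h4.trans ?_
      exact l.commutes x }
  have hθ' : Algebra.TensorProduct.productMap
      (θ'.comp Algebra.TensorProduct.includeLeft) l = θ' := by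
    ext x
    · simp
    · have h5 : l x = θ' (1 ⊗ₜ[k] x) := (RingHom.congr_fun hL x).symm
      have h6 : θ' (1 ⊗ₜ[k] 1) = 1 := map_one θ'
      simp [h5, h6]
  refine ⟨θ'.comp Algebra.TensorProduct.includeLeft, ?_⟩
  rw [hθ']
  exact ⟨h1, h2⟩

theorem exists_common {X X1 X2 U : Scheme.{0}} {Y : Scheme.{0}} (i : U ⟶ X) (j : U ⟶ Y)
    (φ : X1 ⟶ X) (ψ : X2 ⟶ Y) [IsOpenImmersion φ] [IsOpenImmersion ψ] (u : U)
    (h1 : i u ∈ Set.range φ) (h2 : j u ∈ Set.range ψ) :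
    ∃ (W : Scheme.{0}) (w : W ⟶ U) (c : W ⟶ X1) (d : W ⟶ X2), IsOpenImmersion w ∧ Nonempty W ∧
      c ≫ φ = w ≫ i ∧ d ≫ ψ = w ≫ j := by
  obtain ⟨x1, hx1⟩ := h1
  obtain ⟨x2, hx2⟩ := h2
  obtain ⟨z1, hz1, -⟩ := Scheme.Pullback.exists_preimage_pullback (f := i) (g := φ) u x1 hx1.symm
  obtain ⟨z2, hz2, -⟩ := Scheme.Pullback.exists_preimage_pullback (f := j) (g := ψ) u x2 hx2.symm
  obtain ⟨z, -, -⟩ := Scheme.Pullback.exists_preimage_pullback (f := pullback.fst i φ)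
    (g := pullback.fst j ψ) z1 z2 (hz1.trans hz2.symm)
  refine ⟨pullback (pullback.fst i φ) (pullback.fst j ψ), pullback.fst _ _ ≫ pullback.fst _ _,
    pullback.fst _ _ ≫ pullback.snd _ _, pullback.snd _ _ ≫ pullback.snd _ _, inferInstance, ⟨z⟩,
    ?_, ?_⟩
  · rw [Category.assoc, Category.assoc, pullback.condition (f := i) (g := φ)]
  · rw [pullback.condition]
    simp [pullback.condition]

theorem bir_intro {k : Type} [Field k] {X Y W : Scheme.{0}}
    (pX : X ⟶ Spec (CommRingCat.of k)) (pY : Y ⟶ Spec (CommRingCat.of k))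
    (L : Type) [Field L] [Algebra k L] (i : W ⟶ bc pX L) (j : W ⟶ bc pY L)
    (_ : IsOpenImmersion i) (_ : IsOpenImmersion j) [Nonempty W]
    (h : i ≫ bcStruct pX L = j ≫ bcStruct pY L) : BirationalOver pX pY L := by
  obtain ⟨w⟩ := ‹Nonempty W›
  refine ⟨i.opensRange, j.opensRange, ?_, ?_, i.isoOpensRange.symm ≪≫ j.isoOpensRange, ?_⟩
  · intro h0
    have : i w ∈ i.opensRange := ⟨w, rfl⟩
    rw [h0] at this
    exact this
  · intro h0
    have : j w ∈ j.opensRange := ⟨w, rfl⟩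
    rw [h0] at this
    exact this
  · rw [Iso.trans_hom, Iso.symm_hom, Category.assoc, Scheme.Hom.isoOpensRange_hom_ι_assoc, ← h,
      Scheme.Hom.isoOpensRange_inv_comp_assoc]

theorem spec_chart {k A R C : Type} [Field k] [CommRing A] [CommRing R] [CommRing C]
    [Algebra k A] [Algebra k R] [Algebra k C] {X : Scheme.{0}} (p : X ⟶ Spec (CommRingCat.of k))
    (φ : Spec (CommRingCat.of A) ⟶ X) [IsOpenImmersion φ]
    (hφ : φ ≫ p = Spec.map (CommRingCat.ofHom (algebraMap k A)))
    (a : A →ₐ[k] C) (r : R →ₐ[k] C) (f : A ⊗[k] R)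
    (hf : @IsLocalization.Away _ _ f C _
      (Algebra.TensorProduct.productMap a r).toRingHom.toAlgebra) :
    ∃ i : Spec (CommRingCat.of C) ⟶ pullback p (Spec.map (CommRingCat.ofHom (algebraMap k R))),
      IsOpenImmersion i ∧ i ≫ pullback.snd _ _ = Spec.map (CommRingCat.ofHom r.toRingHom) := by
  obtain ⟨j, hj, -, hj2⟩ := isOpenImmersion_chart p
    (Spec.map (CommRingCat.ofHom (algebraMap k R))) φ _ hφ
  let _ := (Algebra.TensorProduct.productMap a r).toRingHom.toAlgebra
  have h1 : IsOpenImmersion (Spec.map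
      (CommRingCat.ofHom (Algebra.TensorProduct.productMap a r).toRingHom)) :=
    IsOpenImmersion.of_isLocalization (S := C) f
  refine ⟨Spec.map (CommRingCat.ofHom (Algebra.TensorProduct.productMap a r).toRingHom) ≫
    (pullbackSpecIso k A R).inv ≫ j, inferInstance, ?_⟩
  rw [Category.assoc, Category.assoc, hj2, pullbackSpecIso_inv_snd, ← Spec.map_comp,
    ← CommRingCat.ofHom_comp]
  congr 2
  ext x
  simp

theorem final_step {k R C : Type} [Field k] [CommRing R] [CommRing C]
    [Algebra k R] [Algebra k C] [Algebra.FiniteType k C] [Nontrivial C] (r : R →ₐ[k] C)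
    {X Y : Scheme.{0}} (pX : X ⟶ Spec (CommRingCat.of k)) (pY : Y ⟶ Spec (CommRingCat.of k))
    (i : Spec (CommRingCat.of C) ⟶ pullback pX (Spec.map (CommRingCat.ofHom (algebraMap k R))))
    (j : Spec (CommRingCat.of C) ⟶ pullback pY (Spec.map (CommRingCat.ofHom (algebraMap k R))))
    (_ : IsOpenImmersion i) (_ : IsOpenImmersion j)
    (hi : i ≫ pullback.snd _ _ = Spec.map (CommRingCat.ofHom r.toRingHom))
    (hj : j ≫ pullback.snd _ _ = Spec.map (CommRingCat.ofHom r.toRingHom)) :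
    ∃ L' : FieldExtension k, FiniteDimensional k L'.carrier ∧
      BirationalOver pX pY L'.carrier := by
  obtain ⟨m, hm⟩ := Ideal.exists_maximal C
  let _ : Field (C ⧸ m) := Ideal.Quotient.field m
  refine ⟨⟨C ⧸ m⟩, ?_, ?_⟩
  · exact finite_of_finite_type_of_isJacobsonRing k (C ⧸ m)
  change BirationalOver pX pY (C ⧸ m)
  let s : Spec (CommRingCat.of (C ⧸ m)) ⟶ Spec (CommRingCat.of R) :=
    Spec.map (CommRingCat.ofHom ((Ideal.Quotient.mk m).comp r.toRingHom))
  have hs : s ≫ Spec.map (CommRingCat.ofHom (algebraMap k R)) = specMap k (C ⧸ m) := by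
    rw [specMap, ← Spec.map_comp, ← CommRingCat.ofHom_comp]
    congr 2
    ext x
    simp
  obtain ⟨i', hi', ei⟩ := isOpenImmersion_baseChange pX _ s _ hs _ i hi
  obtain ⟨j', hj', ej⟩ := isOpenImmersion_baseChange pY _ s _ hs _ j hj
  let q : Spec (CommRingCat.of (C ⧸ m)) ⟶ pullback (Spec.map (CommRingCat.ofHom r.toRingHom)) s :=
    pullback.lift (Spec.map (CommRingCat.ofHom (Ideal.Quotient.mk m))) (𝟙 _) (by
      rw [← Spec.map_comp, ← CommRingCat.ofHom_comp, Category.id_comp])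
  have : Nonempty (Spec (CommRingCat.of (C ⧸ m))) :=
    inferInstanceAs (Nonempty (PrimeSpectrum (C ⧸ m)))
  have : Nonempty ↥(pullback (Spec.map (CommRingCat.ofHom r.toRingHom)) s) :=
    Nonempty.map q inferInstance
  exact bir_intro pX pY _ i' j' hi' hj' (ei.trans ej.symm)

/-- Let `X`, `Y` be geometrically integral `k`-varieties. If
`X_L` is `L`-birational to `Y_L` for some field extension `L/k`, then this
already holds over some finite extension `L'/k`. -/
theorem stmt3 (k : Type) [Field k] (X Y : Scheme.{0})
    (pX : X ⟶ Spec (CommRingCat.of k)) (pY : Y ⟶ Spec (CommRingCat.of k))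
    -- `X`, `Y` are `k`-varieties: separated and of finite type over `k`
    [IsSeparated pX] [LocallyOfFiniteType pX] [QuasiCompact pX]
    [IsSeparated pY] [LocallyOfFiniteType pY] [QuasiCompact pY]
    -- geometrically integral
    (hgX : ∀ (F : Type) [Field F] [Algebra k F], IsIntegral (bc pX F))
    (hgY : ∀ (F : Type) [Field F] [Algebra k F], IsIntegral (bc pY F))
    (h : ∃ L : FieldExtension k, BirationalOver pX pY L.carrier) :
    ∃ L' : FieldExtension k, FiniteDimensional k L'.carrier ∧
      BirationalOver pX pY L'.carrier := by
  obtain ⟨⟨L⟩, U, V, hU, hV, e, he⟩ := h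
  dsimp only at U V e he
  obtain ⟨u⟩ : Nonempty U.toScheme := by
    by_contra h0
    apply hU
    ext x
    exact ⟨fun hx => (h0 ⟨⟨x, hx⟩⟩).elim, fun hx => hx.elim⟩
  let i : U.toScheme ⟶ bc pX L := U.ι
  let j : U.toScheme ⟶ bc pY L := e.hom ≫ V.ι
  have hi : IsOpenImmersion i := inferInstanceAs (IsOpenImmersion U.ι)
  have hj : IsOpenImmersion j := inferInstanceAs (IsOpenImmersion (e.hom ≫ V.ι))
  have hij : j ≫ bcStruct pY L = i ≫ bcStruct pX L := by
    rw [← he]; exact Category.assoc _ _ _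
  obtain ⟨A, _, _, φ, _, _, hxφ, hφ⟩ := exists_chart pX ((i ≫ pullback.fst pX (specMap k L)) u)
  obtain ⟨B, _, _, ψ, _, _, hxψ, hψ⟩ := exists_chart pY ((j ≫ pullback.fst pY (specMap k L)) u)
  obtain ⟨W, w, c, d, _, _, hc, hd⟩ := exists_common _ _ φ ψ u hxφ hxψ
  have hW : IsIntegral W := isIntegral_of_mono_open (w ≫ i) inferInstance (hgX L) inferInstance
  obtain ⟨K, _, s, hs⟩ := exists_generic W
  obtain ⟨l, hl⟩ := Spec.map_surjective (s ≫ (w ≫ i) ≫ bcStruct pX L)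
  have hl2 : Spec.map l = s ≫ (w ≫ j) ≫ bcStruct pY L := by
    rw [hl, Category.assoc, Category.assoc, hij]
  let _ : Algebra k K := (l.hom.comp (algebraMap k L)).toAlgebra
  let l' : L →ₐ[k] K := { l.hom with commutes' := fun x => rfl }
  have hwi : IsOpenImmersion (w ≫ i) := inferInstance
  have hwj : IsOpenImmersion (w ≫ j) := inferInstance
  obtain ⟨a, ha1, ha2⟩ := frac_data pX (hgX L) φ hφ (w ≫ i) hwi c
    (hc.trans (Category.assoc _ _ _).symm) s hs l'
    hl.symm
  obtain ⟨b, hb1, hb2⟩ := frac_data pY (hgY L) ψ hψ (w ≫ j) hwj d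
    (hd.trans (Category.assoc _ _ _).symm) s hs l'
    hl2.symm
  obtain ⟨R, C, _, _, _, _, _, _, a', b', r, f, g, hf, hg⟩ :=
    algebra_core a b l' ha1 hb1 ha2 hb2
  have hC : Algebra.FiniteType k C := by
    let _ := (Algebra.TensorProduct.productMap a' r).toRingHom.toAlgebra
    have h1 : Algebra.FiniteType (A ⊗[k] R) C := IsLocalization.finiteType_of_monoid_fg (Submonoid.powers f) C
    have : IsScalarTower k (A ⊗[k] R) C := IsScalarTower.of_algebraMap_eq fun x =>
      ((Algebra.TensorProduct.productMap a' r).commutes x).symm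
    have h2 : Algebra.FiniteType A (A ⊗[k] R) := inferInstance
    have h3 : Algebra.FiniteType k (A ⊗[k] R) := Algebra.FiniteType.trans ‹Algebra.FiniteType k A› h2
    exact Algebra.FiniteType.trans h3 h1
  obtain ⟨i1, hi1, ei1⟩ := spec_chart pX φ hφ a' r f hf
  obtain ⟨j1, hj1, ej1⟩ := spec_chart pY ψ hψ b' r g hg
  exact final_step r pX pY i1 j1 hi1 hj1 ei1 ej1
end

section
/- Let B be an integral scheme of finite type over an uncountable algebraically closed field k, and let {B_i}_{i∈ℕ} be a countable family of closed subschemes of B. Then the following are equivalent: (i) some B_i equals B; (ii) ⋃_i B_i contains the generic point of B; (iii) B(k) ⊆ ⋃_i B_i(k); (iv) there exists a nonempty open U ⊆ B with U(k) ⊆ ⋃_i B_i(k); (v) there exists a countable family {F_j} of proper closed subsets of B such that B(k) \ ⋃_j F_j(k) ⊆ ⋃_i B_i(k). -/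
open AlgebraicGeometry CategoryTheory CategoryTheory.Limits

/-- A field of countable dimension over an uncountable algebraically closed field is trivial. -/
lemma isAlgebraic_of_rank_le {k K : Type} [Field k] [Uncountable k] [Field K] [Algebra k K]
    (h : Module.rank k K ≤ Cardinal.aleph0) : Algebra.IsAlgebraic k K := by
  by_contra hn
  obtain ⟨x, hx⟩ := (Algebra.transcendental_iff_not_isAlgebraic (R := k) (A := K)).2 hn
  have h2 := (Transcendental.linearIndependent_sub_inv (F := k) hx).cardinal_lift_le_rank
  simp only [Cardinal.lift_id] at h2
  have h3 : Cardinal.aleph0 < Cardinal.mk k := Cardinal.aleph0_lt_mk_iff.2 inferInstance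
  exact absurd (h3.trans_le (h2.trans h)) (lt_irrefl _)

lemma rank_finiteType {k A : Type} [Field k] [CommRing A] [Algebra k A]
    (hft : Algebra.FiniteType k A) : Module.rank k A ≤ Cardinal.aleph0 := by
  obtain ⟨m, f, hf⟩ := Algebra.FiniteType.iff_quotient_mvPolynomial''.1 hft
  refine (LinearMap.rank_le_of_surjective f.toLinearMap hf).trans ?_
  rw [MvPolynomial.rank_eq]
  exact Cardinal.mk_le_aleph0

lemma exists_hom_avoid {k A : Type} [Field k] [IsAlgClosed k] [Uncountable k] [CommRing A]
    [IsDomain A] [Algebra k A] (hft : Algebra.FiniteType k A) {ι : Type} [Countable ι]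
    (f : ι → A) (hf : ∀ i, f i ≠ 0) : ∃ φ : A →ₐ[k] k, ∀ i, φ (f i) ≠ 0 := by
  let Ψ : MvPolynomial ι A →ₐ[A] FractionRing A :=
    MvPolynomial.aeval fun i => (algebraMap A (FractionRing A) (f i))⁻¹
  obtain ⟨M, hM, hle⟩ := Ideal.exists_le_maximal (RingHom.ker Ψ) (RingHom.ker_ne_top _)
  letI : Field (MvPolynomial ι A ⧸ M) := Ideal.Quotient.field M
  have hr : Module.rank k (MvPolynomial ι A ⧸ M) ≤ Cardinal.aleph0 := by
    refine (LinearMap.rank_le_of_surjective (Ideal.Quotient.mkₐ k M).toLinearMap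
      (Ideal.Quotient.mkₐ_surjective k M)).trans ?_
    rw [← rank_mul_rank k A (MvPolynomial ι A), MvPolynomial.rank_eq]
    exact (mul_le_mul' (rank_finiteType hft) Cardinal.mk_le_aleph0).trans
      Cardinal.aleph0_mul_aleph0.le
  haveI : Algebra.IsAlgebraic k (MvPolynomial ι A ⧸ M) := isAlgebraic_of_rank_le hr
  let e : k ≃ₐ[k] (MvPolynomial ι A ⧸ M) := AlgEquiv.ofBijective (Algebra.ofId k _)
    (IsAlgClosed.algebraMap_bijective_of_isIntegral (k := k))
  let g : A →ₐ[k] (MvPolynomial ι A ⧸ M) :=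
    (Ideal.Quotient.mkₐ k M).comp (IsScalarTower.toAlgHom k A (MvPolynomial ι A))
  refine ⟨e.symm.toAlgHom.comp g, fun i hi => ?_⟩
  have h0 : g (f i) = 0 := by
    have : e.symm (g (f i)) = 0 := hi
    simpa using this
  have h1 : MvPolynomial.C (f i) ∈ M := Ideal.Quotient.eq_zero_iff_mem.1 h0
  have h2 : MvPolynomial.C (f i) * MvPolynomial.X i - 1 ∈ M := by
    apply hle
    rw [RingHom.mem_ker]
    have : algebraMap A (FractionRing A) (f i) ≠ 0 := by simpa using hf i
    simp [Ψ, this]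
  apply hM.ne_top
  rw [Ideal.eq_top_iff_one]
  have := M.sub_mem (M.mul_mem_right (MvPolynomial.X i) h1) h2
  simpa using this

lemma exists_point_avoid (k : Type) [Field k] [IsAlgClosed k] [Uncountable k]
    (B : Scheme.{0}) (pB : B ⟶ Spec (CommRingCat.of k))
    [IsIntegral B] [LocallyOfFiniteType pB] {ι : Type} [Countable ι]
    (Z : ι → TopologicalSpace.Closeds B) (hZ : ∀ i, (Z i : Set B) ≠ Set.univ) :
    ∃ s : { s : Spec (CommRingCat.of k) ⟶ B // s ≫ pB = 𝟙 _ }, ∀ i x, s.1.base x ∉ Z i := by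
  obtain ⟨U, hU, hxU, -⟩ := exists_isAffineOpen_mem_and_subset
    (TopologicalSpace.Opens.mem_top (genericPoint B))
  haveI : Nonempty U := ⟨⟨_, hxU⟩⟩
  let ψ : CommRingCat.of k ⟶ Γ(B, U) := Spec.preimage (hU.fromSpec ≫ pB)
  have hψ : Spec.map ψ = hU.fromSpec ≫ pB := Spec.map_preimage _
  letI : Algebra k Γ(B, U) := ψ.hom.toAlgebra
  have hft : Algebra.FiniteType k Γ(B, U) := by
    have h : LocallyOfFiniteType (Spec.map ψ) := by rw [hψ]; infer_instance
    exact (HasRingHomProperty.Spec_iff (P := @LocallyOfFiniteType)).1 h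
  have key : ∀ i, ∃ f : Γ(B, U), f ≠ 0 ∧ ∀ y : Spec Γ(B, U),
      hU.fromSpec.base y ∈ Z i → f ∈ y.asIdeal := by
    intro i
    have hc : IsClosed (hU.fromSpec.base ⁻¹' (Z i : Set B)) :=
      (Z i).isClosed.preimage hU.fromSpec.continuous
    obtain ⟨I, hI⟩ := (PrimeSpectrum.isClosed_iff_zeroLocus _).1 hc
    by_cases h : ∃ f ∈ I, f ≠ 0
    · obtain ⟨f, hfI, hf⟩ := h
      refine ⟨f, hf, fun y hy => ?_⟩
      have : y ∈ PrimeSpectrum.zeroLocus I := by rw [← hI]; exact hy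
      exact this hfI
    · exfalso
      push Not at h
      apply hZ i
      have hall : ∀ y : Spec Γ(B, U), hU.fromSpec.base y ∈ (Z i : Set B) := by
        intro y
        have : y ∈ PrimeSpectrum.zeroLocus I := fun f hf => by
          rw [h f hf]; exact y.asIdeal.zero_mem
        rw [← hI] at this
        exact this
      have hg : genericPoint B ∈ (Z i : Set B) := by
        have : genericPoint B ∈ Set.range hU.fromSpec := by
          rw [hU.range_fromSpec]; exact hxU
        obtain ⟨y, hy⟩ := this
        rw [← hy]; exact hall y
      exact Set.univ_subset_iff.1 (((genericPoint_spec B).mem_closed_set_iff (Z i).isClosed).1 hg)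
  choose f hf hfy using key
  obtain ⟨φ, hφ⟩ := exists_hom_avoid hft f hf
  let φ' : Γ(B, U) ⟶ CommRingCat.of k := CommRingCat.ofHom φ.toRingHom
  have hcomp : ψ ≫ φ' = 𝟙 _ := by
    ext a
    exact φ.commutes a
  refine ⟨⟨Spec.map φ' ≫ hU.fromSpec, ?_⟩, fun i x hx => ?_⟩
  · rw [Category.assoc, ← hψ, ← Spec.map_comp, hcomp, Spec.map_id]
  · have h1 : hU.fromSpec.base ((Spec.map φ').base x) ∈ Z i := by simpa using hx
    have h2 : φ (f i) ∈ x.asIdeal := hfy i _ h1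
    exact x.2.ne_top (Ideal.eq_top_of_isUnit_mem _ h2 (isUnit_iff_ne_zero.2 (hφ i)))

/-- Let `B` be an integral scheme of finite type over an
uncountable algebraically closed field `k`, and `{Bᵢ}` a countable family of
closed subschemes of `B`. The following are equivalent: (i) some `Bᵢ` is all
of `B`; (ii) `⋃ᵢ Bᵢ` contains the generic point of `B`; (iii) it contains all
`k`-points of `B`; (iv) it contains all `k`-points of a nonempty open subset;
(v) it contains all `k`-points outside a countable union of proper closed
subsets. -/
theorem stmt8 (k : Type) [Field k] [IsAlgClosed k] [Uncountable k]
    (B : Scheme.{0}) (pB : B ⟶ Spec (CommRingCat.of k))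
    [IsIntegral B] [LocallyOfFiniteType pB] [QuasiCompact pB] [IsSeparated pB]
    (C : ℕ → TopologicalSpace.Closeds B) :
    -- the `k`-points of `B` are the sections of `pB`
    let KPoint := { s : Spec (CommRingCat.of k) ⟶ B // s ≫ pB = 𝟙 _ }
    let P₁ : Prop := ∃ i, (C i : Set B) = Set.univ
    let P₂ : Prop := genericPoint B ∈ ⋃ i, (C i : Set B)
    let P₃ : Prop := ∀ s : KPoint, ∃ i, ∀ x, s.1.base x ∈ C i
    let P₄ : Prop := ∃ U : B.Opens, U ≠ ⊥ ∧
      ∀ s : KPoint, (∀ x, s.1.base x ∈ U) → ∃ i, ∀ x, s.1.base x ∈ C i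
    let P₅ : Prop := ∃ F : ℕ → TopologicalSpace.Closeds B,
      (∀ j, (F j : Set B) ≠ Set.univ) ∧
      ∀ s : KPoint, (∀ j, ∀ x, s.1.base x ∉ F j) → ∃ i, ∀ x, s.1.base x ∈ C i
    (P₁ ↔ P₂) ∧ (P₁ ↔ P₃) ∧ (P₁ ↔ P₄) ∧ (P₁ ↔ P₅) := by
  intro KPoint P₁ P₂ P₃ P₄ P₅
  have h12 : P₁ ↔ P₂ := by
    constructor
    · rintro ⟨i, hi⟩
      exact Set.mem_iUnion.2 ⟨i, by rw [hi]; trivial⟩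
    · intro h
      obtain ⟨i, hi⟩ := Set.mem_iUnion.1 h
      exact ⟨i, Set.univ_subset_iff.1 (((genericPoint_spec B).mem_closed_set_iff (C i).isClosed).1 hi)⟩
  have h13 : P₁ → P₃ := by
    rintro ⟨i, hi⟩ s
    refine ⟨i, fun x => ?_⟩
    rw [← SetLike.mem_coe, hi]
    trivial
  have h34 : P₃ → P₄ := fun h => ⟨⊤, top_ne_bot, fun s _ => h s⟩
  have h45 : P₄ → P₅ := by
    rintro ⟨U, hU, h⟩
    refine ⟨fun _ => U.compl, fun _ hc => hU ?_, fun s hs => h s fun x => ?_⟩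
    · ext x
      have : x ∈ (U.compl : Set B) := by rw [hc]; trivial
      simpa using this
    · have := hs 0 x
      by_contra hx
      exact this hx
  have h51 : P₅ → P₁ := by
    rintro ⟨F, hF, h⟩
    by_contra hn
    have hC : ∀ i, (C i : Set B) ≠ Set.univ := fun i hi => hn ⟨i, hi⟩
    obtain ⟨s, hs⟩ := exists_point_avoid k B pB (Sum.elim F C) (by
      rintro (j | i)
      · exact hF j
      · exact hC i)
    obtain ⟨i, hi⟩ := h s fun j x => hs (Sum.inl j) x
    let x : Spec (CommRingCat.of k) := (⊥ : PrimeSpectrum k)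
    exact hs (Sum.inr i) x (hi x)
  exact ⟨h12, ⟨h13, fun h => h51 (h45 (h34 h))⟩, ⟨fun h => h34 (h13 h), fun h => h51 (h45 h)⟩,
    ⟨fun h => h45 (h34 (h13 h)), h51⟩⟩
end

section
/- Let S ⊆ ℙ³ over an algebraically closed field of characteristic 0 be the quartic surface defined by g = α(z₀,z₁,z₂)z₃² + β(z₀,z₁,z₂)z₃ + γ(z₀,z₁,z₂) = 0, where α, β, γ are homogeneous forms of degrees 2, 3, 4 with β² − 4αγ = ε₁ε₂, the conic α = 0 is smooth, the cubics ε₁ = 0 and ε₂ = 0 define smooth elliptic curves E₁, E₂ intersecting each other transversally in 9 distinct points not lying on the conic. Then the set M = {g = 0, ∂g/∂z₁ = 0, ∂g/∂z₃ = 0} ∪ {g = 0, ∂g/∂z₂ = 0, ∂g/∂z₃ = 0} ⊆ ℙ³ is finite. -/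
open MvPolynomial

namespace AM

open Polynomial in
lemma clear_denoms {R K : Type*} [CommRing R] [IsDomain R] [Field K] [Algebra R K]
    [IsFractionRing R K] (p : K[X]) :
    ∃ r : R, r ≠ 0 ∧ ∃ q : R[X], q.map (algebraMap R K) = Polynomial.C (algebraMap R K r) * p := by
  obtain ⟨b, hbm, hb⟩ := IsLocalization.integerNormalization_spec (nonZeroDivisors R) p
  refine ⟨b, nonZeroDivisors.ne_zero hbm, _, hb.trans ?_⟩
  rw [← Polynomial.smul_eq_C_mul, algebraMap_smul]

open Polynomial in
lemma dichotomy {R : Type*} [CommRing R] [IsDomain R] [CharZero R] (F : R[X]) :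
    (∃ a b : R[X], ∃ r : R, r ≠ 0 ∧ a * F + b * derivative F = Polynomial.C r) ∨
    (∃ G H : R[X], ∃ m : R, m ≠ 0 ∧ G.natDegree ≠ 0 ∧ Polynomial.C m * F = G * G * H) := by
  classical
  let K := FractionRing R
  have hinj : Function.Injective (algebraMap R K) := IsFractionRing.injective R K
  have : CharZero K := charZero_of_injective_algebraMap hinj
  have hinj' := Polynomial.map_injective _ hinj
  by_cases hs : (F.map (algebraMap R K)).Separable
  · left
    obtain ⟨a, b, hab⟩ := hs
    obtain ⟨r, hr, a', ha⟩ := clear_denoms (R := R) a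
    obtain ⟨s, hs, b', hb⟩ := clear_denoms (R := R) b
    refine ⟨Polynomial.C s * a', Polynomial.C r * b', r * s, mul_ne_zero hr hs, hinj' ?_⟩
    simp only [Polynomial.map_add, Polynomial.map_mul, Polynomial.map_C, ha, hb, ← Polynomial.derivative_map, map_mul]
    linear_combination (Polynomial.C (algebraMap R K r) * Polynomial.C (algebraMap R K s)) * hab
  · right
    rw [PerfectField.separable_iff_squarefree] at hs
    simp only [Squarefree, not_forall] at hs
    obtain ⟨p, ⟨h, hp⟩, hu⟩ := hs
    by_cases hF : F = 0
    · exact ⟨Polynomial.X, 0, 1, one_ne_zero, by simp, by simp [hF]⟩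
    have hp0 : p ≠ 0 := by
      rintro rfl
      apply hF; apply hinj'; simpa using hp
    obtain ⟨r, hr, G, hG⟩ := clear_denoms (R := R) p
    obtain ⟨s, hs, H, hH⟩ := clear_denoms (R := R) h
    refine ⟨G, H, r * r * s, mul_ne_zero (mul_ne_zero hr hr) hs, ?_, hinj' ?_⟩
    · have h1 : (G.map (algebraMap R K)).natDegree = p.natDegree := by
        rw [hG, Polynomial.natDegree_C_mul]
        simpa using hr
      rw [Polynomial.natDegree_map_eq_of_injective hinj] at h1
      rw [h1]
      intro h0
      exact hu (Polynomial.isUnit_iff_degree_eq_zero.2 (by rw [Polynomial.degree_eq_natDegree hp0, h0]; rfl))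
    · simp only [Polynomial.map_mul, Polynomial.map_C, hG, hH, hp, map_mul]
      ring

lemma ringHom_aeval {k A B σ : Type*} [CommRing k] [CommRing A] [CommRing B] [Algebra k A]
    [Algebra k B] (φ : A →+* B) (h : φ.comp (algebraMap k A) = algebraMap k B)
    (g : σ → A) (p : MvPolynomial σ k) :
    φ (aeval g p) = aeval (fun a => φ (g a)) p := by
  rw [map_aeval, h]; rfl

lemma derivative_aeval {k S : Type*} [CommRing k] [CommRing S] [Algebra k S]
    (Q : Fin 3 → Polynomial S) (f : MvPolynomial (Fin 3) k) :
    Polynomial.derivative (aeval Q f) =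
      ∑ a, aeval Q (pderiv a f) * Polynomial.derivative (Q a) := by
  induction f using MvPolynomial.induction_on with
  | C c => simp [Polynomial.algebraMap_apply]
  | add p q hp hq => simp [hp, hq, add_mul, Finset.sum_add_distrib]
  | mul_X p n hp =>
    have h1 : ∀ a, aeval Q (pderiv a (p * X n)) =
        aeval Q (pderiv a p) * Q n + aeval Q p * (if n = a then 1 else 0) := by
      intro a
      rw [pderiv_mul, pderiv_X]
      by_cases h : n = a
      · subst h; simp
      · simp [h]
    simp only [h1]
    rw [map_mul, aeval_X, Polynomial.derivative_mul, hp]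
    simp only [add_mul, Finset.sum_add_distrib, Finset.sum_mul, mul_ite, ite_mul, mul_one,
      mul_zero, zero_mul, Finset.sum_ite_eq, Finset.mem_univ, if_true]
    have h2 : ∑ b, aeval Q (pderiv b p) * Polynomial.derivative (Q b) * Q n =
        ∑ b, aeval Q (pderiv b p) * Q n * Polynomial.derivative (Q b) :=
      Finset.sum_congr rfl fun b _ => mul_right_comm _ _ _
    rw [h2]

lemma eval_smul' {k σ : Type*} [CommRing k] {q : MvPolynomial σ k} {n : ℕ}
    (hq : q.IsHomogeneous n) (c : k) (v : σ → k) : eval (c • v) q = c ^ n * eval v q := by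
  classical
  rw [eval_eq, eval_eq, Finset.mul_sum]
  refine Finset.sum_congr rfl fun d hd => ?_
  have h1 : d.degree = n := by
    by_contra h
    exact (mem_support_iff.1 hd) (hq.coeff_eq_zero h)
  simp only [Pi.smul_apply, smul_eq_mul, mul_pow, Finset.prod_mul_distrib, Finset.prod_pow_eq_pow_sum]
  have : ∑ i ∈ d.support, d i = n := by rw [← h1]; rfl
  rw [this]; ring

/-- A homogeneous polynomial constant on an affine line vanishes at its point at infinity. -/
lemma eval_dir_eq_zero {k σ : Type*} [Field k] [Infinite k] {q : MvPolynomial σ k} {n : ℕ}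
    (hn : n ≠ 0) (hq : q.IsHomogeneous n) (P e : σ → k) (c : k)
    (h : ∀ t : k, eval (P + t • e) q = c) : eval e q = 0 := by
  let Q : Polynomial k := aeval (fun a => Polynomial.X * Polynomial.C (P a) + Polynomial.C (e a)) q
  have hQ : ∀ s, Q.eval s = eval (s • P + e) q := by
    intro s
    have := ringHom_aeval (Polynomial.evalRingHom s) (by ext; simp)
      (fun a => Polynomial.X * Polynomial.C (P a) + Polynomial.C (e a)) q
    simp only [Polynomial.coe_evalRingHom] at this
    rw [this, ← coe_aeval_eq_eval]
    simp only [Polynomial.eval_add, Polynomial.eval_mul, Polynomial.eval_X, Polynomial.eval_C]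
    rfl
  have hz : Q - Polynomial.C c * Polynomial.X ^ n = 0 := by
    apply Polynomial.eq_zero_of_infinite_isRoot
    refine Set.Infinite.mono (s := {0}ᶜ) ?_ (Set.finite_singleton 0).infinite_compl
    intro s hs
    have hs : s ≠ 0 := hs
    have h2 : s • P + e = s • (P + s⁻¹ • e) := by
      rw [smul_add, smul_smul, mul_inv_cancel₀ hs, one_smul]
    change Polynomial.eval s (Q - Polynomial.C c * Polynomial.X ^ n) = 0
    rw [Polynomial.eval_sub, hQ, h2, eval_smul' hq, h, Polynomial.eval_mul, Polynomial.eval_pow,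
      Polynomial.eval_C, Polynomial.eval_X]
    ring
  have := congrArg (Polynomial.eval 0) hz
  simpa [hQ, hn] using this


lemma euler {k : Type*} [CommRing k] {f : MvPolynomial (Fin 3) k} {n : ℕ}
    (hf : f.IsHomogeneous n) (v : Fin 3 → k) :
    ∑ a, v a * eval v (pderiv a f) = n * eval v f := by
  have := congrArg (eval v) hf.sum_X_mul_pderiv
  simpa using this

/-- The vector with entries `t` at `i`, `x` at `j` and `y` at the remaining index. -/
def pt {S : Type*} (i j : Fin 3) (x y t : S) : Fin 3 → S :=
  fun a => if a = i then t else if a = j then x else y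

lemma pt_map {S T : Type*} (φ : S → T) (i j : Fin 3) (x y t : S) :
    (fun a => φ (pt i j x y t a)) = pt i j (φ x) (φ y) (φ t) := by
  funext a; simp only [pt]; split_ifs <;> rfl

lemma sum_ijl {M : Type*} [AddCommMonoid M] {i j l : Fin 3} (hij : i ≠ j) (hil : i ≠ l)
    (hjl : j ≠ l) (u : Fin 3 → M) : ∑ a, u a = u i + u j + u l := by
  have h : (Finset.univ : Finset (Fin 3)) = {i, j, l} := by
    revert i j l; decide
  rw [h, Finset.sum_insert (by simp [hij, hil]), Finset.sum_pair hjl, add_assoc]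

lemma all_ijl {i j l : Fin 3} (hij : i ≠ j) (hil : i ≠ l) (hjl : j ≠ l) (a : Fin 3) :
    a = i ∨ a = j ∨ a = l := by
  revert i j l a; decide

section main

set_option linter.unusedSectionVars false

variable {k : Type*} [Field k] [IsAlgClosed k] [CharZero k] {f : MvPolynomial (Fin 3) k}
  {i j l : Fin 3}

lemma no_sing (hf : f.IsHomogeneous 3)
    (hs : ∀ v : Fin 3 → k, v ≠ 0 → eval v f = 0 → ∃ i, eval v (pderiv i f) ≠ 0)
    (hij : i ≠ j) (hil : i ≠ l) (hjl : j ≠ l) (y t : k)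
    (h0 : eval (pt i j 1 y t) f = 0) (hi : eval (pt i j 1 y t) (pderiv i f) = 0)
    (hl : eval (pt i j 1 y t) (pderiv l f) = 0) : False := by
  have hj1 : pt i j 1 y t j = 1 := by simp [pt, hij.symm]
  have hv : pt i j 1 y t ≠ 0 := by
    intro h
    rw [h] at hj1
    simp at hj1
  obtain ⟨a, ha⟩ := hs _ hv h0
  have he := euler hf (pt i j 1 y t)
  rw [sum_ijl hij hil hjl, hi, hl, h0, hj1] at he
  rcases all_ijl hij hil hjl a with rfl | rfl | rfl
  · exact ha hi
  · apply ha; simpa using he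
  · exact ha hl

/-- restriction to a line through the coordinate point `i` -/
noncomputable def lineT (f : MvPolynomial (Fin 3) k) (i j : Fin 3) (y : k) : Polynomial k :=
  aeval (pt i j 1 (Polynomial.C y) Polynomial.X) f

noncomputable def lineY (f : MvPolynomial (Fin 3) k) (i j : Fin 3) (t : k) : Polynomial k :=
  aeval (pt i j 1 Polynomial.X (Polynomial.C t)) f

noncomputable def biv (f : MvPolynomial (Fin 3) k) (i j : Fin 3) : Polynomial (Polynomial k) :=
  aeval (pt i j 1 (Polynomial.C Polynomial.X) Polynomial.X) f

lemma eval_lineT (y t : k) : (lineT f i j y).eval t = eval (pt i j 1 y t) f := by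
  rw [lineT, ← Polynomial.coe_evalRingHom, ringHom_aeval _ (by ext; simp), pt_map]
  simp

lemma eval_lineY (y t : k) : (lineY f i j t).eval y = eval (pt i j 1 y t) f := by
  rw [lineY, ← Polynomial.coe_evalRingHom, ringHom_aeval _ (by ext; simp), pt_map]
  simp

lemma biv_mapT (y : k) : (biv f i j).map (Polynomial.evalRingHom y) = lineT f i j y := by
  rw [biv, ← Polynomial.coe_mapRingHom, ringHom_aeval _ (by ext; simp [Polynomial.algebraMap_apply]), pt_map]
  simp [lineT]

lemma biv_evalY (t : k) : (biv f i j).eval (Polynomial.C t) = lineY f i j t := by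
  rw [biv, ← Polynomial.coe_evalRingHom, ringHom_aeval _ (by ext; simp [Polynomial.algebraMap_apply]), pt_map]
  simp [lineY]

lemma biv_derivative (hij : i ≠ j) (hil : i ≠ l) (hjl : j ≠ l) :
    Polynomial.derivative (biv f i j) = biv (pderiv i f) i j := by
  rw [biv, derivative_aeval, sum_ijl hij hil hjl]
  simp [pt, hij.symm, hil.symm, hjl.symm, biv]

lemma lineT_derivative (hij : i ≠ j) (hil : i ≠ l) (hjl : j ≠ l) (y : k) :
    Polynomial.derivative (lineT f i j y) = lineT (pderiv i f) i j y := by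
  rw [lineT, derivative_aeval, sum_ijl hij hil hjl]
  simp [pt, hij.symm, hil.symm, hjl.symm, lineT]

lemma lineY_derivative (hij : i ≠ j) (hil : i ≠ l) (hjl : j ≠ l) (t : k) :
    Polynomial.derivative (lineY f i j t) = lineY (pderiv l f) i j t := by
  rw [lineY, derivative_aeval, sum_ijl hij hil hjl]
  simp [pt, hij.symm, hil.symm, hjl.symm, lineY]

/-- A smooth cubic does not contain a line through the coordinate point `i`. -/
lemma lineT_ne_zero (hf : f.IsHomogeneous 3)
    (hs : ∀ v : Fin 3 → k, v ≠ 0 → eval v f = 0 → ∃ i, eval v (pderiv i f) ≠ 0)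
    (hij : i ≠ j) (hil : i ≠ l) (hjl : j ≠ l) (y : k) : lineT f i j y ≠ 0 := by
  intro h0
  have hf0 : ∀ t, eval (pt i j 1 y t) f = 0 := fun t => by rw [← eval_lineT, h0]; simp
  have hfi : ∀ t, eval (pt i j 1 y t) (pderiv i f) = 0 := fun t => by
    rw [← eval_lineT, ← lineT_derivative hij hil hjl, h0]; simp
  have hdeg : (lineT (pderiv l f) i j y).degree = 0 := by
    by_contra hd
    obtain ⟨t, ht⟩ := IsAlgClosed.exists_root _ hd
    rw [Polynomial.IsRoot, eval_lineT] at ht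
    exact no_sing hf hs hij hil hjl y t (hf0 t) (hfi t) ht
  obtain ⟨c, hc⟩ : ∃ c, lineT (pderiv l f) i j y = Polynomial.C c :=
    ⟨_, Polynomial.eq_C_of_degree_eq_zero hdeg⟩
  have hfl : ∀ t, eval (pt i j 1 y t) (pderiv l f) = c := fun t => by
    rw [← eval_lineT, hc]; simp
  have hfj : ∀ t, eval (pt i j 1 y t) (pderiv j f) = - (y * c) := fun t => by
    have he := euler hf (pt i j 1 y t)
    rw [sum_ijl hij hil hjl, hf0, hfi, hfl] at he
    have h1 : pt i j 1 y t j = 1 := by simp [pt, hij.symm]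
    have h2 : pt i j 1 y t l = y := by simp [pt, hil.symm, hjl.symm]
    rw [h1, h2] at he
    linear_combination he
  have hpt : ∀ t : k, pt i j 1 y t = pt i j 1 y 0 + t • Pi.single i 1 := by
    intro t; funext a
    by_cases h : a = i <;> simp [pt, h]
  have hne : (Pi.single i 1 : Fin 3 → k) ≠ 0 := by simp
  have hl : ∀ (q : MvPolynomial (Fin 3) k) (c : k), (∀ t, eval (pt i j 1 y t) q = c) →
      ∀ t : k, eval (pt i j 1 y 0 + t • Pi.single i 1) q = c := fun q c h t => by
    rw [← hpt]; exact h t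
  obtain ⟨a, ha⟩ := hs _ hne (eval_dir_eq_zero (by norm_num) hf _ _ _ (hl _ _ hf0))
  apply ha
  rcases all_ijl hij hil hjl a with rfl | rfl | rfl
  · exact eval_dir_eq_zero (n := 2) (by norm_num) hf.pderiv _ _ _ (hl _ _ hfi)
  · exact eval_dir_eq_zero (n := 2) (by norm_num) hf.pderiv _ _ _ (hl _ _ hfj)
  · exact eval_dir_eq_zero (n := 2) (by norm_num) hf.pderiv _ _ _ (hl _ _ hfl)

/-- Finiteness in the affine chart `z j = 1`. -/
lemma chart_finite (hf : f.IsHomogeneous 3)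
    (hs : ∀ v : Fin 3 → k, v ≠ 0 → eval v f = 0 → ∃ i, eval v (pderiv i f) ≠ 0)
    (hij : i ≠ j) (hil : i ≠ l) (hjl : j ≠ l) :
    {v : Fin 3 → k | v j = 1 ∧ eval v f = 0 ∧ eval v (pderiv i f) = 0}.Finite := by
  rcases dichotomy (biv f i j) with ⟨a, b, r, hr, hab⟩ | ⟨G, H, m, hm, hG, hGH⟩
  · have hfin : (⋃ y ∈ {y | r.IsRoot y}, (fun t => pt i j 1 y t) '' {t | (lineT f i j y).IsRoot t}).Finite := by
      refine (Polynomial.finite_setOfPred_isRoot hr).biUnion fun y _ => ?_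
      exact (Polynomial.finite_setOfPred_isRoot (lineT_ne_zero hf hs hij hil hjl y)).image _
    refine hfin.subset ?_
    rintro v ⟨hvj, h0, hi⟩
    have hv : v = pt i j 1 (v l) (v i) := by
      funext a
      rcases all_ijl hij hil hjl a with rfl | rfl | rfl
      · simp [pt]
      · simp [pt, hij.symm, hvj]
      · simp [pt, hil.symm, hjl.symm]
    rw [hv] at h0 hi
    have hl0 : (lineT f i j (v l)).eval (v i) = 0 := by rw [eval_lineT, h0]
    simp only [Set.mem_iUnion]
    refine ⟨v l, ?_, v i, hl0, hv.symm⟩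
    have h1 := congrArg (fun p => (p.map (Polynomial.evalRingHom (v l))).eval (v i)) hab
    simp only [biv_derivative hij hil hjl, Polynomial.map_add, Polynomial.map_mul, biv_mapT,
      Polynomial.eval_add, Polynomial.eval_mul, eval_lineT, h0, hi, Polynomial.map_C,
      Polynomial.eval_C, mul_zero, add_zero] at h1
    exact h1.symm
  · exfalso
    have hlc : m * G.leadingCoeff ≠ 0 := by
      refine mul_ne_zero hm (Polynomial.leadingCoeff_ne_zero.2 ?_)
      rintro rfl; simp at hG
    obtain ⟨y, hy⟩ : ∃ y, (m * G.leadingCoeff).eval y ≠ 0 := by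
      by_contra! h
      exact hlc (Polynomial.funext fun y => by simpa using h y)
    rw [Polynomial.eval_mul] at hy
    have hmy := left_ne_zero_of_mul hy
    have hdeg : (G.map (Polynomial.evalRingHom y)).natDegree = G.natDegree :=
      Polynomial.natDegree_map_of_leadingCoeff_ne_zero _ (right_ne_zero_of_mul hy)
    obtain ⟨t, ht⟩ := IsAlgClosed.exists_root (G.map (Polynomial.evalRingHom y)) (by
      intro h
      rw [Polynomial.natDegree_eq_of_degree_eq_some h] at hdeg
      exact hG hdeg.symm)
    -- the identity as polynomials in `t`
    have hT := congrArg (fun p => p.map (Polynomial.evalRingHom y)) hGH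
    simp only [Polynomial.map_mul, biv_mapT, Polynomial.map_C] at hT
    have hTd := congrArg (fun p => (Polynomial.derivative p).eval t) hT
    have h0 := congrArg (fun p => p.eval t) hT
    have ht : (G.map (Polynomial.evalRingHom y)).eval t = 0 := ht
    simp only [Polynomial.derivative_mul, Polynomial.derivative_C, Polynomial.eval_add,
      Polynomial.eval_mul, ht, lineT_derivative hij hil hjl, eval_lineT, Polynomial.eval_C,
      Polynomial.coe_evalRingHom, Polynomial.eval_zero,
      zero_mul, mul_zero, zero_add, add_zero, mul_eq_zero, hmy, false_or] at hTd h0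
    have hY := congrArg (fun p => p.eval (Polynomial.C t)) hGH
    simp only [Polynomial.eval_mul, biv_evalY, Polynomial.eval_C] at hY
    have hYd := congrArg (fun p => (Polynomial.derivative p).eval y) hY
    have htY : (G.eval (Polynomial.C t)).eval y = 0 := by
      have h := Polynomial.eval₂_at_apply (p := G) (Polynomial.evalRingHom y) (Polynomial.C t)
      rw [Polynomial.coe_evalRingHom, Polynomial.eval_C] at h
      rw [← h, ← Polynomial.eval_map, ht]
    simp only [Polynomial.derivative_mul, Polynomial.eval_add,
      Polynomial.eval_mul, htY, lineY_derivative hij hil hjl, eval_lineY, h0,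
      zero_mul, mul_zero, zero_add, add_zero, mul_eq_zero, hmy, false_or] at hYd
    exact no_sing hf hs hij hil hjl y t h0 hTd hYd

/-- Up to scaling, only finitely many points of the cone. -/
lemma cone_finite (hf : f.IsHomogeneous 3)
    (hs : ∀ v : Fin 3 → k, v ≠ 0 → eval v f = 0 → ∃ i, eval v (pderiv i f) ≠ 0) (i : Fin 3) :
    ∃ T : Set (Fin 3 → k), T.Finite ∧ ∀ v : Fin 3 → k, v ≠ 0 → eval v f = 0 →
      eval v (pderiv i f) = 0 → ∃ u ∈ T, ∃ c : k, c ≠ 0 ∧ v = c • u := by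
  obtain ⟨j, l, hij, hil, hjl⟩ : ∃ j l : Fin 3, i ≠ j ∧ i ≠ l ∧ j ≠ l := by
    revert i; decide
  refine ⟨_, ((chart_finite hf hs hij hil hjl).union
    (chart_finite hf hs hil hij hjl.symm)).union (Set.finite_singleton (Pi.single i 1)), ?_⟩
  intro v hv h0 hi
  by_cases hj : v j = 0
  · by_cases hl : v l = 0
    · refine ⟨_, Or.inr rfl, v i, ?_, ?_⟩
      · intro hi0
        apply hv
        funext a
        rcases all_ijl hij hil hjl a with rfl | rfl | rfl <;> assumption
      · funext a
        rcases all_ijl hij hil hjl a with rfl | rfl | rfl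
        · simp
        · simp [hij.symm, hj]
        · simp [hil.symm, hl]
    · refine ⟨(v l)⁻¹ • v, Or.inl (Or.inr ⟨by simp [hl], ?_, ?_⟩), v l, hl, ?_⟩
      · rw [eval_smul' hf, h0, mul_zero]
      · rw [eval_smul' hf.pderiv, hi, mul_zero]
      · rw [smul_smul, mul_inv_cancel₀ hl, one_smul]
  · refine ⟨(v j)⁻¹ • v, Or.inl (Or.inl ⟨by simp [hj], ?_, ?_⟩), v j, hj, ?_⟩
    · rw [eval_smul' hf, h0, mul_zero]
    · rw [eval_smul' hf.pderiv, hi, mul_zero]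
    · rw [smul_smul, mul_inv_cancel₀ hj, one_smul]

end main

end AM

/-- With `S ⊆ ℙ³` the quartic surface
`g = α z₃² + β z₃ + γ = 0` attached to an Artin–Mumford configuration
(a smooth conic `α = 0`, smooth cubics `ε₁ = 0`, `ε₂ = 0` meeting
transversally in 9 distinct points not on the conic, and
`β² - 4αγ = ε₁ε₂`), the locus
`M = {g = ∂g/∂z₁ = ∂g/∂z₃ = 0} ∪ {g = ∂g/∂z₂ = ∂g/∂z₃ = 0}` is finite. -/
theorem stmt10 (k : Type) [Field k] [IsAlgClosed k] [CharZero k]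
    (α β γ ε₁ ε₂ : MvPolynomial (Fin 3) k)
    (hα : α.IsHomogeneous 2) (hβ : β.IsHomogeneous 3) (hγ : γ.IsHomogeneous 4)
    (hε₁ : ε₁.IsHomogeneous 3) (hε₂ : ε₂.IsHomogeneous 3)
    (hdisc : β ^ 2 - 4 * α * γ = ε₁ * ε₂)
    -- the conic `A : α = 0` is smooth
    (hA : ∀ v : Fin 3 → k, v ≠ 0 → eval v α = 0 → ∃ i, eval v (pderiv i α) ≠ 0)
    -- the cubic curves `E₁ : ε₁ = 0` and `E₂ : ε₂ = 0` are smooth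
    (hE₁ : ∀ v : Fin 3 → k, v ≠ 0 → eval v ε₁ = 0 → ∃ i, eval v (pderiv i ε₁) ≠ 0)
    (hE₂ : ∀ v : Fin 3 → k, v ≠ 0 → eval v ε₂ = 0 → ∃ i, eval v (pderiv i ε₂) ≠ 0)
    -- `E₁ ∩ E₂` consists of 9 distinct points
    (hcard : {p : Projectivization k (Fin 3 → k) |
        eval p.rep ε₁ = 0 ∧ eval p.rep ε₂ = 0}.ncard = 9)
    -- the intersections of `E₁` and `E₂` are transversal
    (htrans : ∀ v : Fin 3 → k, v ≠ 0 → eval v ε₁ = 0 → eval v ε₂ = 0 →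
      LinearIndependent k
        ![fun i => eval v (pderiv i ε₁), fun i => eval v (pderiv i ε₂)])
    -- no point of `E₁ ∩ E₂` lies on the conic
    (hAE : ∀ v : Fin 3 → k, v ≠ 0 → eval v ε₁ = 0 → eval v ε₂ = 0 →
      eval v α ≠ 0) :
    let g : MvPolynomial (Fin 4) k :=
      rename Fin.castSucc α * X 3 ^ 2 + rename Fin.castSucc β * X 3 +
        rename Fin.castSucc γ
    {p : Projectivization k (Fin 4 → k) |
      eval p.rep g = 0 ∧ eval p.rep (pderiv 3 g) = 0 ∧
        (eval p.rep (pderiv 1 g) = 0 ∨ eval p.rep (pderiv 2 g) = 0)}.Finite := by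
  intro g
  classical
  have h2 : (2 : k) ≠ 0 := two_ne_zero
  obtain ⟨T, hT, hTm⟩ : ∃ T : Set (Fin 3 → k), T.Finite ∧ ∀ v : Fin 3 → k, v ≠ 0 →
      eval v (ε₁ * ε₂) = 0 →
      (eval v (pderiv 1 (ε₁ * ε₂)) = 0 ∨ eval v (pderiv 2 (ε₁ * ε₂)) = 0) →
      ∃ u ∈ T, ∃ c : k, c ≠ 0 ∧ v = c • u := by
    obtain ⟨T1, hT1, hm1⟩ := AM.cone_finite hε₁ hE₁ 1
    obtain ⟨T2, hT2, hm2⟩ := AM.cone_finite hε₁ hE₁ 2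
    obtain ⟨T3, hT3, hm3⟩ := AM.cone_finite hε₂ hE₂ 1
    obtain ⟨T4, hT4, hm4⟩ := AM.cone_finite hε₂ hE₂ 2
    have hT5 := (Set.finite_of_ncard_ne_zero (by rw [hcard]; norm_num)).image
      (fun p : Projectivization k (Fin 3 → k) => p.rep) (s := {p : Projectivization k (Fin 3 → k) |
        eval p.rep ε₁ = 0 ∧ eval p.rep ε₂ = 0})
    refine ⟨_, (((hT1.union hT2).union hT3).union hT4).union hT5, ?_⟩
    intro v hv h0 hd
    rw [map_mul, mul_eq_zero] at h0
    simp only [pderiv_mul, map_add, map_mul] at hd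
    by_cases ha : eval v ε₁ = 0
    · by_cases hb : eval v ε₂ = 0
      · obtain ⟨c, hc⟩ := Projectivization.exists_smul_eq_mk_rep k v hv
        have hc' : (c : k) • v = (Projectivization.mk k v hv).rep := hc
        refine ⟨_, Or.inr ⟨Projectivization.mk k v hv, ⟨?_, ?_⟩, rfl⟩, (c : k)⁻¹, by simp, ?_⟩
        · rw [← hc', AM.eval_smul' hε₁, ha, mul_zero]
        · rw [← hc', AM.eval_smul' hε₂, hb, mul_zero]
        · simp only []
          rw [← hc', smul_smul, inv_mul_cancel₀ c.ne_zero, one_smul]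
      · simp only [ha, zero_mul, add_zero, mul_eq_zero, hb, or_false] at hd
        rcases hd with hd | hd
        · obtain ⟨u, hu, h⟩ := hm1 v hv ha hd
          exact ⟨u, by simp [hu], h⟩
        · obtain ⟨u, hu, h⟩ := hm2 v hv ha hd
          exact ⟨u, by simp [hu], h⟩
    · have hb : eval v ε₂ = 0 := h0.resolve_left ha
      simp only [hb, mul_zero, zero_add, mul_eq_zero, ha, false_or] at hd
      rcases hd with hd | hd
      · obtain ⟨u, hu, h⟩ := hm3 v hv hb hd
        exact ⟨u, by simp [hu], h⟩
      · obtain ⟨u, hu, h⟩ := hm4 v hv hb hd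
        exact ⟨u, by simp [hu], h⟩
  -- the lift of a plane point to the surface
  let L : (Fin 3 → k) → (Fin 4 → k) := fun u =>
    Fin.snoc (α := fun _ => k) u (-(eval u β) / (2 * eval u α))
  have hfin : {p : Projectivization k (Fin 4 → k) |
      ∃ u ∈ insert (Pi.single 3 1) (L '' T), ∃ c : k, p.rep = c • u}.Finite := by
    have h1 := (hT.image L).insert (Pi.single 3 1)
    refine (h1.image (fun u => if hu : u ≠ 0 then Projectivization.mk k u hu else
      Projectivization.mk k (Pi.single 3 1) (by simp))).subset ?_
    rintro p ⟨u, hu, c, hc⟩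
    have hu0 : u ≠ 0 := by
      rintro rfl
      exact p.rep_nonzero (by rw [hc, smul_zero])
    refine ⟨u, hu, ?_⟩
    simp only [dif_pos hu0]
    rw [← p.mk_rep, eq_comm, Projectivization.mk_eq_mk_iff']
    exact ⟨c, hc.symm⟩
  refine hfin.subset ?_
  intro p hp
  obtain ⟨hg, hg3, hg12⟩ := hp
  set z : Fin 4 → k := p.rep with hz
  set v : Fin 3 → k := fun a => z a.castSucc with hv
  set w : k := z 3 with hw
  have hzv : z = Fin.snoc (α := fun _ => k) v w := by
    funext a
    refine Fin.lastCases ?_ (fun b => ?_) a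
    · rw [Fin.snoc_last]; rfl
    · rw [Fin.snoc_castSucc]
  have hren : ∀ q : MvPolynomial (Fin 3) k, eval z (rename Fin.castSucc q) = eval v q := by
    intro q; rw [eval_rename]; rfl
  have hinj := Fin.castSucc_injective 3
  have hpd : ∀ (a : Fin 3) (q : MvPolynomial (Fin 3) k),
      eval z (pderiv a.castSucc (rename Fin.castSucc q)) = eval v (pderiv a q) := by
    intro a q; rw [pderiv_rename hinj, hren]
  have hpd3 : ∀ (q : MvPolynomial (Fin 3) k),
      pderiv (3 : Fin 4) (rename Fin.castSucc q) = 0 := by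
    intro q
    apply pderiv_eq_zero_of_notMem_vars
    intro h
    have := vars_rename Fin.castSucc q h
    simp only [Finset.mem_image] at this
    obtain ⟨b, _, hb⟩ := this
    exact absurd hb (Fin.castSucc_lt_last b).ne
  have e0 : eval v α * w ^ 2 + eval v β * w + eval v γ = 0 := by
    simpa [g, hren] using hg
  have e3 : 2 * eval v α * w + eval v β = 0 := by
    simp [g, hren, hpd3, pderiv_X, Derivation.leibniz_pow] at hg3
    linear_combination hg3
  have eg : ∀ a : Fin 3, eval z (pderiv a.castSucc g) =
      eval v (pderiv a α) * w ^ 2 + eval v (pderiv a β) * w + eval v (pderiv a γ) := by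
    intro a
    have ha : (a.castSucc : Fin 4) ≠ 3 := (Fin.castSucc_lt_last a).ne
    have hX : pderiv a.castSucc (X 3 : MvPolynomial (Fin 4) k) = 0 :=
      pderiv_X_of_ne ha.symm
    simp only [g, map_add, pderiv_mul, pderiv_pow, hX, map_mul, map_pow, eval_X, hpd, mul_zero,
      add_zero, map_zero]
    rfl
  have eD : eval v (ε₁ * ε₂) = eval v β ^ 2 - 4 * eval v α * eval v γ := by
    rw [← hdisc]; simp
  have eDa : ∀ a, eval v (pderiv a (ε₁ * ε₂)) = 2 * eval v β * eval v (pderiv a β)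
      - 4 * (eval v (pderiv a α) * eval v γ + eval v α * eval v (pderiv a γ)) := by
    intro a
    have h4 : (4 : MvPolynomial (Fin 3) k) = C 4 := (map_ofNat C 4).symm
    rw [← hdisc, h4]
    simp only [map_sub, map_add, pderiv_mul, pderiv_pow, pderiv_C, map_mul, map_pow, eval_C,
      map_zero]
    simp
    ring
  by_cases hv0 : v = 0
  · refine ⟨_, Or.inl rfl, w, ?_⟩
    change z = _
    rw [hzv, hv0]
    funext a
    refine Fin.lastCases ?_ (fun b => ?_) a
    · rw [Fin.snoc_last]
      change w = w * (Pi.single 3 1 : Fin 4 → k) 3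
      simp
    · rw [Fin.snoc_castSucc]
      have hb : (b.castSucc : Fin 4) ≠ 3 := (Fin.castSucc_lt_last b).ne
      simp [hb]
  have hD0 : eval v (ε₁ * ε₂) = 0 := by
    rw [eD]
    linear_combination (eval v β + 2 * eval v α * w) * e3 - 4 * eval v α * e0
  have hα0 : eval v α ≠ 0 := by
    intro h
    have hβ0 : eval v β = 0 := by rw [h] at e3; simpa using e3
    have hγ0 : eval v γ = 0 := by rw [h, hβ0] at e0; simpa using e0
    have hDa : ∀ a, eval v (pderiv a (ε₁ * ε₂)) = 0 := fun a => by
      rw [eDa, h, hβ0, hγ0]; ring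
    simp only [pderiv_mul, map_add, map_mul] at hDa
    rw [map_mul, mul_eq_zero] at hD0
    rcases hD0 with h1 | h1
    · obtain ⟨a, ha⟩ := hE₁ v hv0 h1
      have := hDa a
      simp only [h1, zero_mul, add_zero, mul_eq_zero, ha, false_or] at this
      exact hAE v hv0 h1 this h
    · obtain ⟨a, ha⟩ := hE₂ v hv0 h1
      have := hDa a
      simp only [h1, mul_zero, zero_add, mul_eq_zero, ha, or_false] at this
      exact hAE v hv0 this h1 h
  have hDD : ∀ a, eval z (pderiv a.castSucc g) = 0 → eval v (pderiv a (ε₁ * ε₂)) = 0 := by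
    intro a ha
    rw [eg] at ha
    rw [eDa]
    linear_combination (2 * eval v (pderiv a β) + 4 * w * eval v (pderiv a α)) * e3
      - 4 * eval v (pderiv a α) * e0 - 4 * eval v α * ha
  obtain ⟨u, hu, c, hc, hvu⟩ := hTm v hv0 hD0 (hg12.imp (hDD 1) (hDD 2))
  refine ⟨L u, Or.inr ⟨u, hu, rfl⟩, c, ?_⟩
  have hwu : w = c * (-(eval u β) / (2 * eval u α)) := by
    have hαu : eval v α = c ^ 2 * eval u α := by rw [hvu, AM.eval_smul' hα]
    have hβu : eval v β = c ^ 3 * eval u β := by rw [hvu, AM.eval_smul' hβ]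
    have hau : eval u α ≠ 0 := by
      intro h; apply hα0; rw [hαu, h, mul_zero]
    rw [hαu, hβu] at e3
    have hc2 : c ^ 2 ≠ 0 := pow_ne_zero 2 hc
    field_simp
    apply mul_left_cancel₀ hc2
    linear_combination e3
  change z = _
  rw [hzv]
  funext a
  refine Fin.lastCases ?_ (fun b => ?_) a
  · rw [Fin.snoc_last, Pi.smul_apply]
    simp only [L, Fin.snoc_last]
    exact hwu
  · rw [Fin.snoc_castSucc, Pi.smul_apply]
    simp only [L, Fin.snoc_castSucc]
    rw [hvu]; rfl
end

section
/- Let k be a field of characteristic ≠ 3 and K = k(θ) a cubic Galois extension of k with group G. Consider the affine variety V over K̄ = K (after base change to K, the splitting field) given in coordinates (u,v,w,x) by u·v·w = x(x−1), x ≠ 0, i.e. V is the open subvariety of the affine cubic hypersurface uvw = x(x−1) where x is invertible. Then over K: (a) Pic(V) = 0, and (b) every invertible regular function on V is of the form c·xʳ·uⁿ·vᵐ with c ∈ K^×, r, n, m ∈ ℤ. -/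
set_option synthInstance.maxHeartbeats 1000000
set_option maxHeartbeats 1000000
open MvPolynomial

/-- The affine cubic `u v w = x (x - 1)`. -/
noncomputable def cubicRel (K : Type) [Field K] : MvPolynomial (Fin 4) K :=
  X 0 * X 1 * X 2 - X 3 * (X 3 - 1)

/-- The coordinate ring of the affine cubic hypersurface `u v w = x (x - 1)`. -/
noncomputable abbrev CubicRing (K : Type) [Field K] : Type :=
  MvPolynomial (Fin 4) K ⧸ Ideal.span {cubicRel K}

/-- The coordinate ring of `V`, the open locus `x ≠ 0` of the affine cubic
`u v w = x (x - 1)`. -/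
noncomputable abbrev VRing (K : Type) [Field K] : Type :=
  Localization.Away (Ideal.Quotient.mk (Ideal.span {cubicRel K}) (X 3))


/-- Nagata-type criterion. -/
theorem aux_ufd {A R : Type} [CommRing A] [IsDomain A] [UniqueFactorizationMonoid A]
    [CommRing R] [IsDomain R] [IsNoetherianRing R] (ψ : A →+* R)
    (hinj : Function.Injective ψ) (a b c : A) (ha : Prime (ψ a)) (hb : Prime (ψ b))
    (hc : IsUnit (ψ c)) (hba : ¬ ψ b ∣ ψ a)
    (hs : ∀ r : R, ∃ (n : ℕ) (p : A), r * ψ (a * b * c) ^ n = ψ p) :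
    UniqueFactorizationMonoid R := by
  let R1 := Localization.Away (ψ a)
  let b1 : R1 := algebraMap R R1 (ψ b)
  let R2 := Localization.Away b1
  have hle : Submonoid.powers (ψ a) ≤ nonZeroDivisors R :=
    powers_le_nonZeroDivisors_of_noZeroDivisors ha.ne_zero
  have hR1 : Function.Injective (algebraMap R R1) := IsLocalization.injective R1 hle
  have : IsDomain R1 := IsLocalization.Away.isDomain R1 ha.ne_zero
  have : IsNoetherianRing R1 := IsLocalization.isNoetherianRing (Submonoid.powers (ψ a)) R1
    inferInstance
  have hb10 : b1 ≠ 0 := by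
    intro h
    exact hb.ne_zero (hR1 (by simpa [b1] using h))
  have hb1 : Prime b1 := by
    refine (IsLocalization.toLocalizationMap (Submonoid.powers (ψ a)) R1).map_prime hb hb10 ?_
    intro hu
    have hu' : IsUnit (algebraMap R R1 (ψ b)) := hu
    obtain ⟨z, hz⟩ := hu'.exists_right_inv
    obtain ⟨n, r, hr⟩ := IsLocalization.Away.surj (ψ a) z
    have h1 : algebraMap R R1 (ψ a ^ n) = algebraMap R R1 (ψ b * r) := by
      rw [map_mul, ← hr, ← mul_assoc, hz, one_mul, map_pow]
    exact hba (hb.dvd_of_dvd_pow ⟨r, hR1 h1⟩)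
  rw [UniqueFactorizationMonoid.iff_of_isLocalizationAway_of_prime ha R1,
    UniqueFactorizationMonoid.iff_of_isLocalizationAway_of_prime hb1 R2]
  have : IsDomain R2 := IsLocalization.Away.isDomain R2 hb10
  have hR2 : Function.Injective (algebraMap R1 R2) := IsLocalization.injective R2
    (powers_le_nonZeroDivisors_of_noZeroDivisors hb10)
  let f : A →+* R2 := ((algebraMap R1 R2).comp (algebraMap R R1)).comp ψ
  have hf : Function.Injective f := hR2.comp (hR1.comp hinj)
  let : Algebra A R2 := f.toAlgebra
  have hfa : ∀ p, algebraMap A R2 p = algebraMap R1 R2 (algebraMap R R1 (ψ p)) := fun p => rfl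
  have hua : IsUnit (algebraMap R1 R2 (algebraMap R R1 (ψ a))) :=
    (IsLocalization.Away.algebraMap_isUnit (ψ a)).map _
  have hub : IsUnit (algebraMap R1 R2 (algebraMap R R1 (ψ b))) :=
    IsLocalization.Away.algebraMap_isUnit b1
  have huc : IsUnit (algebraMap R1 R2 (algebraMap R R1 (ψ c))) := (hc.map _).map _
  have : IsLocalization (Submonoid.powers (a * b * c)) R2 := by
    refine ⟨?_, ?_, ?_⟩
    · rintro ⟨_, n, rfl⟩
      simp only [map_pow, map_mul, hfa]
      exact ((hua.mul hub).mul huc).pow n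
    · intro z
      obtain ⟨n, y, hy⟩ := IsLocalization.Away.surj b1 z
      obtain ⟨m, r, hr⟩ := IsLocalization.Away.surj (ψ a) y
      obtain ⟨l, p, hp⟩ := hs r
      refine ⟨(p * (a * c) ^ n * (b * c) ^ m, ⟨(a * b * c) ^ (n + m + l), n + m + l, rfl⟩), ?_⟩
      simp only [map_pow, map_mul, hfa, ← hp] at hy ⊢
      simp only [← hr, map_pow, map_mul, ← hy, b1]
      ring
    · intro p q h
      exact ⟨1, by rw [hf h]⟩
  exact UniqueFactorizationMonoid.of_isLocalization (Submonoid.powers (a * b * c)) R2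

theorem aux_prime {D R : Type} [CommRing D] [IsDomain D] [CommRing R] (φ : R →+* D)
    (s : D →+* R) (u : R) (hu0 : u ≠ 0) (hu : φ u = 0) (h : ∀ r, u ∣ r - s (φ r)) : Prime u := by
  have key : ∀ r, φ r = 0 → u ∣ r := fun r hr => by simpa [hr] using h r
  refine ⟨hu0, ?_, ?_⟩
  · intro h1
    have := h1.map φ
    rw [hu] at this
    exact not_isUnit_zero this
  · rintro a b ⟨c, hc⟩
    have h2 : φ a * φ b = 0 := by rw [← map_mul, hc, map_mul, hu, zero_mul]
    rcases mul_eq_zero.1 h2 with h3 | h3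
    · exact Or.inl (key a h3)
    · exact Or.inr (key b h3)

section VR
variable (K : Type) [Field K]

/-- Structure map. -/
noncomputable def vq : MvPolynomial (Fin 4) K →+* VRing K :=
  (algebraMap (CubicRing K) (VRing K)).comp (Ideal.Quotient.mk (Ideal.span {cubicRel K}))

theorem vq_eq : algebraMap (MvPolynomial (Fin 4) K) (VRing K) = vq K := rfl

theorem vq_unit : IsUnit (vq K (X 3)) :=
  IsLocalization.Away.algebraMap_isUnit
    (Ideal.Quotient.mk (Ideal.span {cubicRel K}) (X 3))

theorem vq_rel : vq K (X 0) * vq K (X 1) * vq K (X 2) = vq K (X 3) * (vq K (X 3) - 1) := by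
  have h : vq K (cubicRel K) = 0 := by
    have : Ideal.Quotient.mk (Ideal.span {cubicRel K}) (cubicRel K) = 0 :=
      Ideal.Quotient.eq_zero_iff_mem.2 (Ideal.subset_span rfl)
    simp only [vq, RingHom.comp_apply, this, map_zero]
  simp only [cubicRel, map_sub, map_mul, map_one] at h
  exact sub_eq_zero.1 h

theorem vq_surj (r : VRing K) : ∃ (n : ℕ) (p : MvPolynomial (Fin 4) K),
    r * vq K (X 3) ^ n = vq K p := by
  obtain ⟨n, y, hy⟩ := IsLocalization.Away.surj
    (Ideal.Quotient.mk (Ideal.span {cubicRel K}) (X 3)) r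
  obtain ⟨p, rfl⟩ := Ideal.Quotient.mk_surjective y
  exact ⟨n, p, hy⟩

theorem vq_hom_ext {B : Type} [CommRing B] (f g : VRing K →+* B)
    (hC : ∀ c, f (vq K (C c)) = g (vq K (C c)))
    (hX : ∀ i, f (vq K (X i)) = g (vq K (X i))) : f = g := by
  refine IsLocalization.ringHom_ext
    (Submonoid.powers (Ideal.Quotient.mk (Ideal.span {cubicRel K}) (X 3))) ?_
  refine Ideal.Quotient.ringHom_ext ?_
  refine MvPolynomial.ringHom_ext ?_ ?_
  · exact hC
  · exact hX

theorem vq_lift {B : Type} [CommRing B] [Algebra K B] (t : Fin 4 → B) (h3 : IsUnit (t 3))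
    (hrel : t 0 * t 1 * t 2 = t 3 * (t 3 - 1)) :
    ∃ f : VRing K →+* B, (∀ c, f (vq K (C c)) = algebraMap K B c) ∧
      ∀ i, f (vq K (X i)) = t i := by
  let g : CubicRing K →+* B := Ideal.Quotient.lift _ (aeval t : MvPolynomial (Fin 4) K →ₐ[K] B).toRingHom
    (by
      intro a ha
      obtain ⟨b, rfl⟩ := Ideal.mem_span_singleton'.1 ha
      simp [cubicRel, hrel])
  have hg : ∀ p, g (Ideal.Quotient.mk (Ideal.span {cubicRel K}) p) = aeval t p := fun p => rfl
  have hu : IsUnit (g (Ideal.Quotient.mk (Ideal.span {cubicRel K}) (X 3))) := by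
    rw [hg]; simpa using h3
  refine ⟨IsLocalization.Away.lift _ hu, ?_, ?_⟩
  · intro c
    simp only [vq, RingHom.comp_apply]
    rw [IsLocalization.Away.lift_eq, hg, aeval_C]
  · intro i
    simp only [vq, RingHom.comp_apply]
    rw [IsLocalization.Away.lift_eq, hg, aeval_X]

theorem vq_scalar (c : K) : vq K (C c) = algebraMap K (VRing K) c := rfl

/-- The subring of `u, v, x`. -/
noncomputable def vpsi : MvPolynomial (Fin 3) K →+* VRing K :=
  eval₂Hom ((vq K).comp C) ![vq K (X 0), vq K (X 1), vq K (X 3)]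

theorem vpsi_C (c : K) : vpsi K (C c) = vq K (C c) := by simp [vpsi]
theorem vpsi_0 : vpsi K (X 0) = vq K (X 0) := by simp [vpsi]
theorem vpsi_1 : vpsi K (X 1) = vq K (X 1) := by simp [vpsi]
theorem vpsi_2 : vpsi K (X 2) = vq K (X 3) := by simp [vpsi]

theorem vpsi_inj : Function.Injective (vpsi K) := by
  let A := MvPolynomial (Fin 3) K
  let L := FractionRing A
  let i : A →+* L := algebraMap A L
  have hi : Function.Injective i := IsFractionRing.injective A L
  have hne : ∀ j : Fin 3, i (X j) ≠ 0 := fun j h =>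
    X_ne_zero (R := K) j (hi (by rw [h, map_zero]))
  obtain ⟨f, hfC, hfX⟩ := vq_lift K (B := L)
    ![i (X 0), i (X 1), i (X 2) * (i (X 2) - 1) / (i (X 0) * i (X 1)), i (X 2)]
    (by simpa using hne 2)
    (by
      have h0 := hne 0
      have h1 := hne 1
      exact mul_div_cancel₀ _ (mul_ne_zero h0 h1))
  have hcomp : f.comp (vpsi K) = i := by
    refine MvPolynomial.ringHom_ext ?_ ?_
    · intro c
      rw [RingHom.comp_apply, vpsi_C, hfC]
      exact IsScalarTower.algebraMap_apply K A L c
    · intro j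
      fin_cases j
      · simp [vpsi_0, hfX]
      · simp [vpsi_1, hfX]
      · simp [vpsi_2, hfX]
  intro p q h
  apply hi
  rw [← hcomp, RingHom.comp_apply, h, RingHom.comp_apply]

theorem vpsi_surj (r : VRing K) : ∃ (n : ℕ) (p : MvPolynomial (Fin 3) K),
    r * vpsi K (X 0 * X 1 * X 2) ^ n = vpsi K p := by
  have hpoly : ∀ p : MvPolynomial (Fin 4) K, ∃ (n : ℕ) (q : MvPolynomial (Fin 3) K),
      vq K p * vpsi K (X 0 * X 1 * X 2) ^ n = vpsi K q := by
    intro p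
    induction p using MvPolynomial.induction_on with
    | C c => exact ⟨0, C c, by simp [vpsi_C]⟩
    | add p q hp hq =>
      obtain ⟨n, p', hp⟩ := hp
      obtain ⟨m, q', hq⟩ := hq
      refine ⟨n + m, p' * (X 0 * X 1 * X 2) ^ m + q' * (X 0 * X 1 * X 2) ^ n, ?_⟩
      rw [map_add, map_add, map_mul _ p', map_mul _ q', ← hp, ← hq, map_pow, map_pow]
      ring
    | mul_X p j hp =>
      obtain ⟨n, p', hp⟩ := hp
      have hj : ∃ q : MvPolynomial (Fin 3) K,
          vq K (X j) * vpsi K (X 0 * X 1 * X 2) = vpsi K q := by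
        fin_cases j
        · exact ⟨X 0 * (X 0 * X 1 * X 2), by simp [vpsi_0, vpsi_1, vpsi_2]⟩
        · exact ⟨X 1 * (X 0 * X 1 * X 2), by simp [vpsi_0, vpsi_1, vpsi_2]⟩
        · refine ⟨X 2 * (X 2 - 1) * X 2, ?_⟩
          simp only [map_mul, map_sub, map_one, vpsi_0, vpsi_1, vpsi_2, ← vq_rel]
          change vq K (X 2) * _ = _
          ring
        · exact ⟨X 2 * (X 0 * X 1 * X 2), by simp [vpsi_0, vpsi_1, vpsi_2]⟩
      obtain ⟨q, hq⟩ := hj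
      refine ⟨n + 1, p' * q, ?_⟩
      rw [map_mul _ p, map_mul _ p', ← hp, ← hq]
      ring
  obtain ⟨n, p, hp⟩ := vq_surj K r
  obtain ⟨m, q, hq⟩ := hpoly p
  refine ⟨n + m, q * (X 0 * X 1) ^ n, ?_⟩
  rw [map_mul (vpsi K) q, ← hq, ← hp]
  simp only [map_mul, map_pow, vpsi_0, vpsi_1, vpsi_2]
  ring

theorem vq_prime [IsDomain (VRing K)] (i j : Fin 4) (t : Fin 4 → MvPolynomial (Fin 2) K)
    (hrel : t 0 * t 1 * t 2 = 0) (hi : t i = 0) (hj : t j = X 0) (h3 : t 3 = 1)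
    (hdvd : vq K (X i) ∣ vq K (X 0) * vq K (X 1) * vq K (X 2))
    (hi0 : vq K (X i) ≠ 0)
    (hsec : ∀ l, l ≠ i → l ≠ 3 → l ≠ j → l = 2 ∧ t 2 = X 1) :
    Prime (vq K (X i)) ∧ ¬ vq K (X i) ∣ vq K (X j) := by
  obtain ⟨f, hfC, hfX⟩ := vq_lift K t (by simp [h3]) (by simp [hrel, h3])
  let s : MvPolynomial (Fin 2) K →+* VRing K :=
    eval₂Hom ((vq K).comp C) ![vq K (X j), vq K (X 2)]
  have hf0 : f (vq K (X i)) = 0 := by rw [hfX, hi]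
  refine ⟨aux_prime f s _ hi0 hf0 ?_, ?_⟩
  · intro r
    rw [← Ideal.mem_span_singleton, ← Ideal.Quotient.eq]
    let π := Ideal.Quotient.mk (Ideal.span {vq K (X i)})
    have hext : π = (π.comp s).comp f := by
      refine vq_hom_ext K _ _ ?_ ?_
      · intro c
        simp [hfC, s, MvPolynomial.algebraMap_eq]
      · intro l
        simp only [RingHom.comp_apply, hfX]
        by_cases hli : l = i
        · subst hli
          rw [hi, map_zero, map_zero]
          exact Ideal.Quotient.eq_zero_iff_mem.2 (Ideal.mem_span_singleton_self _)
        by_cases hl3 : l = 3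
        · subst hl3
          rw [h3, map_one, map_one, ← sub_eq_zero, ← map_one π, ← map_sub]
          refine Ideal.Quotient.eq_zero_iff_mem.2 (Ideal.mem_span_singleton.2 ?_)
          rw [vq_rel] at hdvd
          exact (vq_unit K).dvd_mul_left.1 hdvd
        by_cases hlj : l = j
        · subst hlj
          rw [hj]
          simp [s]
        · obtain ⟨rfl, h2⟩ := hsec l hli hl3 hlj
          rw [h2]
          simp [s]
    exact congrArg (fun g => g r) hext
  · rintro ⟨c, hc⟩
    have := congrArg f hc
    rw [map_mul, hf0, zero_mul, hfX, hj] at this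
    exact X_ne_zero _ this

theorem vq_ne (j : Fin 3) : vpsi K (X j) ≠ 0 := fun h =>
  X_ne_zero (R := K) j (vpsi_inj K (by rw [h, map_zero]))

theorem v_ufd [IsDomain (VRing K)] : UniqueFactorizationMonoid (VRing K) := by
  have : IsNoetherianRing (VRing K) := IsLocalization.isNoetherianRing
    (Submonoid.powers (Ideal.Quotient.mk (Ideal.span {cubicRel K}) (X 3))) _ inferInstance
  have h0 := vq_prime K 0 1 ![0, X 0, X 1, 1] (by simp) (by simp) (by simp) (by simp)
    ⟨vq K (X 1) * vq K (X 2), by ring⟩ (by rw [← vpsi_0]; exact vq_ne K 0)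
    (by intro l; fin_cases l <;> simp)
  have h1 := vq_prime K 1 0 ![X 0, 0, X 1, 1] (by simp) (by simp) (by simp) (by simp)
    ⟨vq K (X 0) * vq K (X 2), by ring⟩ (by rw [← vpsi_1]; exact vq_ne K 1)
    (by intro l; fin_cases l <;> simp)
  refine aux_ufd (vpsi K) (vpsi_inj K) (X 0) (X 1) (X 2) ?_ ?_ ?_ ?_ (vpsi_surj K)
  · rw [vpsi_0]; exact h0.1
  · rw [vpsi_1]; exact h1.1
  · rw [vpsi_2]; exact vq_unit K
  · rw [vpsi_0, vpsi_1]; exact h1.2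

theorem v_units [IsDomain (VRing K)] (a : (VRing K)ˣ) : ∃ (c : K) (n : ℕ) (e : Fin 3 →₀ ℕ),
    c ≠ 0 ∧ (a : VRing K) * vpsi K (X 0 * X 1 * X 2) ^ n = vpsi K (monomial e c) := by
  obtain ⟨n, p, hp⟩ := vpsi_surj K (a : VRing K)
  obtain ⟨m, q, hq⟩ := vpsi_surj K ((a⁻¹ : (VRing K)ˣ) : VRing K)
  have hpq : p * q = (X 0 * X 1 * X 2) ^ (n + m) := by
    apply vpsi_inj K
    rw [map_mul, ← hp, ← hq, map_pow]
    calc _ = ((a : VRing K) * ((a⁻¹ : (VRing K)ˣ) : VRing K)) *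
          (vpsi K (X 0 * X 1 * X 2)) ^ (n + m) := by ring
      _ = _ := by rw [Units.mul_inv, one_mul]
  have hmon : ((X 0 * X 1 * X 2) ^ (n + m) : MvPolynomial (Fin 3) K) =
      monomial ((n + m) • (Finsupp.single 0 1 + Finsupp.single 1 1 + Finsupp.single 2 1)) 1 := by
    simp only [X, monomial_mul, monomial_pow, one_pow, mul_one]
  rw [hmon] at hpq
  obtain ⟨e, c, _, hc, rfl⟩ := (dvd_monomial_iff_exists (one_ne_zero' K)).1 ⟨q, hpq.symm⟩
  refine ⟨c, n, e, ?_, hp⟩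
  rintro rfl
  exact zero_ne_one (zero_dvd_iff.1 hc).symm

end VR

/-- Let `k` be a field of characteristic `≠ 3` and `K/k` a
cubic Galois extension. Let `V` be the open subvariety `x ≠ 0` of the affine
cubic `u·v·w = x(x-1)` over `K` (the split form of the norm hypersurface).
Then (a) `Pic(V) = 0`, i.e. every invertible module over its coordinate ring
`R` is free of rank 1, and (b) every invertible regular function on `V` is of
the form `c·xʳ·uⁿ·vᵐ` with `c ∈ K*` and `r, n, m ∈ ℤ`. -/
theorem stmt15 (k : Type) [Field k] (hchar : ringChar k ≠ 3)
    (K : Type) [Field K] [Algebra k K] [IsGalois k K]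
    (hdeg : Module.finrank k K = 3)
    -- (the coordinate ring of `V` is an integral domain)
    [IsDomain (VRing K)] :
    -- (a) `Pic V = 0`: every invertible `R`-module is free of rank one
    (∀ (M N : Type) [AddCommGroup M] [Module (VRing K) M]
        [AddCommGroup N] [Module (VRing K) N],
      Nonempty ((TensorProduct (VRing K) M N) ≃ₗ[VRing K] VRing K) →
        Nonempty (M ≃ₗ[VRing K] VRing K)) ∧
    -- (b) units of `R` are of the form `c·xʳ·uⁿ·vᵐ` (as elements of the
    -- fraction field of `R`)
    (∀ a : (VRing K)ˣ, ∃ (c : Kˣ) (r n m : ℤ),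
      algebraMap (VRing K) (FractionRing (VRing K)) (a : VRing K) =
        algebraMap (VRing K) (FractionRing (VRing K))
            (algebraMap (MvPolynomial (Fin 4) K) (VRing K) (C (c : K))) *
          (algebraMap (VRing K) (FractionRing (VRing K))
            (algebraMap (MvPolynomial (Fin 4) K) (VRing K) (X 3))) ^ r *
          (algebraMap (VRing K) (FractionRing (VRing K))
            (algebraMap (MvPolynomial (Fin 4) K) (VRing K) (X 0))) ^ n *
          (algebraMap (VRing K) (FractionRing (VRing K))
            (algebraMap (MvPolynomial (Fin 4) K) (VRing K) (X 1))) ^ m) := by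
  refine ⟨?_, ?_⟩
  · intro M N _ _ _ _ ⟨e⟩
    have := v_ufd K
    have : Module.Invertible (VRing K) M := Module.Invertible.left e
    exact Module.Invertible.free_iff_linearEquiv.1 inferInstance
  · intro a
    obtain ⟨c, n, e, hc, h⟩ := v_units K a
    refine ⟨Units.mk0 c hc, (e 2 : ℤ) - n, (e 0 : ℤ) - n, (e 1 : ℤ) - n, ?_⟩
    simp only [vq_eq, Units.val_mk0]
    have hinj : Function.Injective (algebraMap (VRing K) (FractionRing (VRing K))) :=
      IsFractionRing.injective _ _
    have hne : ∀ j : Fin 3, algebraMap (VRing K) (FractionRing (VRing K)) (vpsi K (X j)) ≠ 0 :=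
      fun j h => vq_ne K j (hinj (by rw [h, map_zero]))
    have h' := congrArg (algebraMap (VRing K) (FractionRing (VRing K))) h
    rw [monomial_eq, Finsupp.prod_fintype _ _ (by simp), Fin.prod_univ_three] at h'
    simp only [map_mul, map_pow] at h'
    rw [vpsi_C] at h'
    have h0 := hne 0
    have h1 := hne 1
    have h2 := hne 2
    rw [← vpsi_0, ← vpsi_1, ← vpsi_2, zpow_sub₀ h0, zpow_sub₀ h1, zpow_sub₀ h2]
    simp only [zpow_natCast]
    field_simp
    linear_combination h'
end

section
/- Let k be an uncountable algebraically closed field, B an integral scheme of finite type over k, X an integral k-scheme, and p : X → B a dominant projective morphism. Suppose there is a countable family {G_i}_{i∈ℕ} of closed subschemes of X such that for every closed point c ∈ X, the fiber X_{p(c)} admits a decomposition of the diagonal if and only if c ∈ ⋃_i G_i. If there exists a k-point b₀ ∈ B(k) such that the fiber X_{b₀} does not admit a decomposition of the diagonal, then none of the closed sets p(G_i) equals B; consequently a very general point b ∈ B(k) (i.e., b outside a countable union of proper closed subsets) has fiber X_b not admitting a decomposition of the diagonal. -/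
open AlgebraicGeometry CategoryTheory CategoryTheory.Limits

attribute [local instance] MvPolynomial.gradedAlgebra

/-- Projective `n`-space over a field `k`, as a scheme. -/
noncomputable def ProjSpace (k : Type) [Field k] (n : ℕ) : Scheme.{0} :=
  Proj (MvPolynomial.homogeneousSubmodule (Fin (n + 1)) k)

/-- The structure morphism `ℙⁿ_k ⟶ Spec k`. -/
noncomputable def ProjSpace.structMap (k : Type) [Field k] (n : ℕ) :
    ProjSpace k n ⟶ Spec (CommRingCat.of k) :=
  Proj.toSpecZero _ ≫ Spec.map (CommRingCat.ofHom
    (algebraMap k (MvPolynomial.homogeneousSubmodule (Fin (n + 1)) k 0)))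

lemma ProjSpace.isProper_structMap (k : Type) [Field k] (n : ℕ) :
    IsProper (ProjSpace.structMap k n) := by
  have hbij : Function.Bijective
      (algebraMap k (MvPolynomial.homogeneousSubmodule (Fin (n + 1)) k 0)) := by
    refine ⟨fun a b hab => MvPolynomial.C_injective (Fin (n + 1)) k
      (congrArg Subtype.val hab), ?_⟩
    rintro ⟨x, hx⟩
    have hx' := hx
    rw [MvPolynomial.homogeneousSubmodule_zero] at hx'
    obtain ⟨a, ha⟩ := Submodule.mem_one.mp hx'
    exact ⟨a, Subtype.ext ha⟩
  have h1 : IsIso (CommRingCat.ofHom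
      (algebraMap k (MvPolynomial.homogeneousSubmodule (Fin (n + 1)) k 0))) := by
    rw [ConcreteCategory.isIso_iff_bijective]
    exact hbij
  have h2 : Algebra.FiniteType (MvPolynomial.homogeneousSubmodule (Fin (n + 1)) k 0)
      (MvPolynomial (Fin (n + 1)) k) := by
    have : IsScalarTower k (MvPolynomial.homogeneousSubmodule (Fin (n + 1)) k 0)
      (MvPolynomial (Fin (n + 1)) k) :=
      ⟨fun a b c => smul_mul_assoc a (b : MvPolynomial (Fin (n + 1)) k) c⟩
    exact Algebra.FiniteType.of_restrictScalars_finiteType k _ _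
  have h3 : IsProper (Proj.toSpecZero (MvPolynomial.homogeneousSubmodule (Fin (n + 1)) k)) :=
    inferInstance
  have h4 : IsProper (Spec.map (CommRingCat.ofHom
    (algebraMap k (MvPolynomial.homogeneousSubmodule (Fin (n + 1)) k 0)))) := inferInstance
  exact MorphismProperty.comp_mem @IsProper _ _ h3 h4

/-- Lifting `k`-points of `B` to `k`-points of a closed subset of `X` meeting the fiber. -/
lemma exists_lift_point (k : Type) [Field k] [IsAlgClosed k]
    (B X : Scheme.{0}) (pB : B ⟶ Spec (CommRingCat.of k)) (p : X ⟶ B)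
    [LocallyOfFiniteType pB] [LocallyOfFiniteType p]
    (G : Set X) (hG : IsClosed G)
    (b : Spec (CommRingCat.of k) ⟶ B) (hb : b ≫ pB = 𝟙 _)
    (h : ∃ x ∈ G, p x = b (IsLocalRing.closedPoint k)) :
    ∃ c : Spec (CommRingCat.of k) ⟶ X, c ≫ p ≫ pB = 𝟙 _ ∧ c ≫ p = b ∧ ∀ x, c x ∈ G := by
  have hcl : IsClosed {b (IsLocalRing.closedPoint k)} :=
    (pointEquivClosedPoint pB ⟨b, hb⟩).2
  have : JacobsonSpace X := LocallyOfFiniteType.jacobsonSpace (p ≫ pB)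
  have hZ : IsClosed (G ∩ p ⁻¹' {b (IsLocalRing.closedPoint k)}) :=
    hG.inter (hcl.preimage p.continuous)
  obtain ⟨x, ⟨hx1, hx2⟩, hx3⟩ := nonempty_inter_closedPoints
    (Z := G ∩ p ⁻¹' {b (IsLocalRing.closedPoint k)})
    (by obtain ⟨x, h1, h2⟩ := h; exact ⟨x, h1, h2⟩) hZ.isLocallyClosed
  replace hx3 : IsClosed {x} := hx3
  have hc := pointOfClosedPoint_comp (p ≫ pB) x hx3
  refine ⟨pointOfClosedPoint (p ≫ pB) x hx3, hc, ?_, ?_⟩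
  · refine ext_of_apply_closedPoint_eq pB (by simp) hb ?_
    exact (Scheme.Hom.comp_apply _ _ _).trans
      ((congrArg p (pointOfClosedPoint_apply (p ≫ pB) x hx3 _)).trans hx2)
  · intro a
    rw [pointOfClosedPoint_apply]
    exact hx1

/-- Let `k` be an uncountable algebraically closed field,
`p : X ⟶ B` a dominant projective morphism of integral finite type
`k`-schemes, and suppose that the locus of (closed) points `c` of `X` whose
fiber `X_{p(c)}` admits a decomposition of the diagonal (an arbitrary property
`DD` of `k`-varieties here) is a countable union `⋃ᵢ Gᵢ` of closed subsets.
If some fiber `X_{b₀}` admits no decomposition of the diagonal, then no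
`p(Gᵢ)` is all of `B`, and a very general `b ∈ B(k)` (outside the closures of
the `p(Gᵢ)`) has fiber admitting no decomposition of the diagonal. -/
theorem stmt16 (k : Type) [Field k] [IsAlgClosed k] [Uncountable k]
    (B X : Scheme.{0}) (pB : B ⟶ Spec (CommRingCat.of k)) (p : X ⟶ B)
    [IsIntegral B] [IsIntegral X]
    [LocallyOfFiniteType pB] [QuasiCompact pB] [IsSeparated pB]
    -- `p` is projective: it factors through a closed immersion into `ℙⁿ_B`
    (hproj : ∃ (n : ℕ) (ι : X ⟶ pullback (ProjSpace.structMap k n) pB),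
      IsClosedImmersion ι ∧ ι ≫ pullback.snd (ProjSpace.structMap k n) pB = p)
    -- `p` is dominant
    (hdom : Dense (Set.range p.base))
    -- `DD W q` abstractly stands for: the `k`-variety `W` (with structure
    -- morphism `q`) admits a decomposition of the diagonal
    (DD : ∀ (W : Scheme.{0}), (W ⟶ Spec (CommRingCat.of k)) → Prop)
    -- a countable family of closed subsets of `X` such that the fiber through
    -- a closed (= `k`-rational) point `c` of `X` admits a decomposition of
    -- the diagonal iff `c ∈ ⋃ᵢ Gᵢ`
    (G : ℕ → TopologicalSpace.Closeds X)
    (hG : ∀ c : { c : Spec (CommRingCat.of k) ⟶ X // c ≫ p ≫ pB = 𝟙 _ },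
      DD (pullback p ((c : Spec (CommRingCat.of k) ⟶ X) ≫ p))
          (pullback.snd p ((c : Spec (CommRingCat.of k) ⟶ X) ≫ p)) ↔
        ∃ i, ∀ x, (c : Spec (CommRingCat.of k) ⟶ X).base x ∈ G i)
    -- a `k`-point `b₀` whose fiber admits no decomposition of the diagonal
    (b₀ : Spec (CommRingCat.of k) ⟶ B) (hb₀ : b₀ ≫ pB = 𝟙 _)
    (hDDb₀ : ¬ DD (pullback p b₀) (pullback.snd p b₀)) :
    (∀ i, p.base '' (G i) ≠ Set.univ) ∧
    ∀ b : Spec (CommRingCat.of k) ⟶ B, b ≫ pB = 𝟙 _ →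
      (∀ i, ∀ x, b.base x ∉ closure (p.base '' (G i))) →
      ¬ DD (pullback p b) (pullback.snd p b) := by
  obtain ⟨n, ι, hι, hp⟩ := hproj
  have hproper := ProjSpace.isProper_structMap k n
  have hpp : IsProper p := by
    rw [← hp]; infer_instance
  have hd : IsDominant p := ⟨hdom⟩
  have hs : Surjective p := inferInstance
  refine ⟨fun i hi => ?_, fun b hb hbG hDD => ?_⟩
  · obtain ⟨c, hc, hcb, hcG⟩ := exists_lift_point k B X pB p (G i) (G i).isClosed b₀ hb₀
      (by
        have : b₀ (IsLocalRing.closedPoint k) ∈ p.base '' (G i) := by rw [hi]; trivial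
        exact this)
    subst hcb
    exact hDDb₀ ((hG ⟨c, hc⟩).2 ⟨i, hcG⟩)
  · obtain ⟨x, hx⟩ := p.surjective (b (IsLocalRing.closedPoint k))
    obtain ⟨c, hc, hcb, -⟩ := exists_lift_point k B X pB p Set.univ isClosed_univ b hb
      ⟨x, trivial, hx⟩
    subst hcb
    obtain ⟨i, hi⟩ := (hG ⟨c, hc⟩).1 hDD
    refine hbG i (IsLocalRing.closedPoint k) (subset_closure ?_)
    exact ⟨_, hi (IsLocalRing.closedPoint k), (Scheme.Hom.comp_apply _ _ _).symm⟩
end
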